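/- arXiv:1710.00394 — 6 statements merged into one kernel-verified Lean document; each statement's English description precedes it below -/
import Mathlib

section
/- Let D be a bounded ℂ-convex domain in ℂⁿ and let p ∈ ∂D be an extreme ℂ-convex boundary point of D. Then p is a holomorphic peak point of D. -/
open Set Topology Filter

noncomputable section

variable {E : Type*} [NormedAddCommGroup E] [NormedSpace ℂ E]

/-- A complex affine line in a complex normed space. -/
def IsComplexAffineLine (L : Set E) : Prop :=
  ∃ a v : E, v ≠ 0 ∧ L = {x | ∃ t : ℂ, x = a + t • v}

/-- A complex affine hyperplane: a level set of a nonzero continuous ℂ-linear functional. -/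
def IsComplexAffineHyperplane (H : Set E) : Prop :=
  ∃ (f : E →L[ℂ] ℂ) (c : ℂ), f ≠ 0 ∧ H = {x | f x = c}

/-- A domain `D` is ℂ-convex if its intersection with every complex affine line meeting it
is connected and simply connected. -/
def IsCConvex (D : Set E) : Prop :=
  ∀ L : Set E, IsComplexAffineLine L → (L ∩ D).Nonempty →
    IsConnected (L ∩ D) ∧ SimplyConnectedSpace ↥(L ∩ D)

/-- `p` is an extreme ℂ-convex boundary point of `D`. -/
def ExtremeCConvexAt (D : Set E) (p : E) : Prop :=
  ∃ H : Set E, IsComplexAffineHyperplane H ∧ p ∈ H ∧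
    ∃ U : Set E, IsOpen U ∧ p ∈ U ∧ H ∩ closure D ∩ U = {p}

/-- `p` is a globally extreme ℂ-convex boundary point of `D`. -/
def GloballyExtremeCConvexAt (D : Set E) (p : E) : Prop :=
  ∃ H : Set E, IsComplexAffineHyperplane H ∧ p ∈ H ∧ H ∩ closure D = {p}

/-- `p` is a strictly ℂ-convex boundary point of `D`. -/
def StrictlyCConvexAt (D : Set E) (p : E) : Prop :=
  ∃ U : Set E, IsOpen U ∧ p ∈ U ∧
    ∀ H : Set E, IsComplexAffineHyperplane H → p ∈ H → H ∩ D = ∅ →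
      U ∩ closure D ∩ H = {p}

/-- `p` is a globally strictly ℂ-convex boundary point of `D`. -/
def GloballyStrictlyCConvexAt (D : Set E) (p : E) : Prop :=
  ∀ H : Set E, IsComplexAffineHyperplane H → p ∈ H → H ∩ D = ∅ →
    closure D ∩ H = {p}

/-- `p` is a normal boundary point of `D`. -/
def NormalAt (D : Set E) (p : E) : Prop :=
  ∀ U : Set E, IsOpen U → p ∈ U →
    ∃ V : Set E, IsOpen V ∧ p ∈ V ∧ V ⊆ U ∧
      ∀ x ∈ V ∩ D, ∀ y ∈ V ∩ D, JoinedIn (U ∩ D) x y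

/-- `p` is a strongly normal boundary point of `D`. -/
def StronglyNormalAt (D : Set E) (p : E) : Prop :=
  ∀ U : Set E, IsOpen U → p ∈ U →
    ∃ V : Set E, IsOpen V ∧ p ∈ V ∧ V ⊆ U ∧ IsConnected (V ∩ D)

/-- The Wirtinger-type derivative `∂ρ(z)(X) = (dρ(z)(X) - i·dρ(z)(iX))/2` of a real-valued
function; for `ρ` real-valued this is the complex-linear part of the real differential, so that
`∂ρ(z)(X) = Σ_j (∂ρ/∂z_j)(z)·X_j` in coordinates. -/
def wirtingerDeriv (ρ : E → ℝ) (z X : E) : ℂ :=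
  (((fderiv ℝ ρ z X : ℝ) : ℂ) - Complex.I * ((fderiv ℝ ρ z (Complex.I • X) : ℝ) : ℂ)) / 2

/-- The second (real) derivative `D²ρ(z)(X,Y)`. -/
def secondDerivAt (ρ : E → ℝ) (z X Y : E) : ℝ :=
  fderiv ℝ (fderiv ℝ ρ) z X Y

/-- `U`, `ρ`, `c` witness that the bounded domain `D` is a `C^k`-smooth strongly linearly
convex domain. -/
def IsSLCDefiningData (k : ℕ∞) (D U : Set E) (ρ : E → ℝ) (c : ℝ) : Prop :=
  IsOpen U ∧ frontier D ⊆ U ∧ ContDiffOn ℝ k ρ U ∧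
  frontier D = {z ∈ U | ρ z = 0} ∧ D ∩ U = {z ∈ U | ρ z < 0} ∧
  (∀ z ∈ U, fderiv ℝ ρ z ≠ 0) ∧ 0 < c ∧
  (∀ z ∈ frontier D, ∀ X : E, wirtingerDeriv ρ z X = 0 →
    c * ‖X‖ ^ 2 ≤ secondDerivAt ρ z X X)

end

/-- Every zero-free continuous function on `D` has a continuous logarithm on `D`. -/
def HasContinuousLogs {X : Type*} [TopologicalSpace X] (D : Set X) : Prop :=
  ∀ g : X → ℂ, ContinuousOn g D → (∀ z ∈ D, g z ≠ 0) →
    ∃ l : X → ℂ, ContinuousOn l D ∧ ∀ z ∈ D, Complex.exp (l z) = g z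

theorem eqOn_of_exp_eqOn {X : Type*} [TopologicalSpace X] {s : Set X} (hs : IsPreconnected s)
    {l₁ l₂ : X → ℂ} (h₁ : ContinuousOn l₁ s) (h₂ : ContinuousOn l₂ s)
    (he : ∀ x ∈ s, Complex.exp (l₁ x) = Complex.exp (l₂ x)) {a : X} (ha : a ∈ s)
    (h : l₁ a = l₂ a) : ∀ x ∈ s, l₁ x = l₂ x := by
  refine fun x hx ↦ Complex.isCoveringMap_exp.eqOn_of_comp_eqOn hs h₁ h₂
    (fun y hy ↦ ?_) ha h hx
  simpa using he y hy

theorem isSimplyConnected_univ_complex : IsSimplyConnected (univ : Set ℂ) :=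
  (Homeomorph.Set.univ ℂ).toHomotopyEquiv.simplyConnectedSpace

theorem re_pos_of_norm_sub_one_lt {w : ℂ} (h : ‖w - 1‖ < 1) : 0 < w.re := by
  have := (Complex.abs_re_le_norm (w - 1)).trans_lt h
  rw [abs_lt] at this
  simp at this
  linarith

theorem log_mul_of_re_pos {w u : ℂ} (hw : 0 < w.re) (hu : 0 < u.re) :
    Complex.log (w * u) = Complex.log w + Complex.log u := by
  have h1 := abs_lt.1 (Complex.abs_arg_lt_pi_div_two_iff.2 (Or.inl hw))
  have h2 := abs_lt.1 (Complex.abs_arg_lt_pi_div_two_iff.2 (Or.inl hu))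
  refine Complex.log_mul (by rintro rfl; simp at hw) (by rintro rfl; simp at hu) ?_
  constructor <;> linarith [h1.1, h1.2, h2.1, h2.2]

theorem differentiableOn_of_exp_eq {G : Set ℂ} (hG : IsOpen G) {g l : ℂ → ℂ}
    (hg : DifferentiableOn ℂ g G) (hl : ContinuousOn l G)
    (he : ∀ z ∈ G, Complex.exp (l z) = g z) : DifferentiableOn ℂ l G := by
  intro z hz
  have hzG := hG.mem_nhds hz
  have hc := hl.continuousAt hzG
  have hgz : g z ≠ 0 := he z hz ▸ Complex.exp_ne_zero _
  have h1 : ∀ᶠ w in 𝓝 z, ‖l w - l z‖ < 1 := by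
    filter_upwards [hc (Metric.ball_mem_nhds _ one_pos)] with w hw
    simpa [dist_eq_norm] using hw
  have h2 : l =ᶠ[𝓝 z] fun w ↦ l z + Complex.log (g w / g z) := by
    filter_upwards [h1, hzG] with w hw hwG
    have him := abs_lt.1 ((Complex.abs_im_le_norm (l w - l z)).trans_lt hw)
    rw [← he w hwG, ← he z hz, ← Complex.exp_sub, Complex.log_exp]
    · ring
    · linarith [Real.pi_gt_three]
    · linarith [Real.pi_gt_three]
  refine (DifferentiableAt.congr_of_eventuallyEq ?_ h2).differentiableWithinAt
  have := hg.differentiableAt hzG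
  refine (DifferentiableAt.clog (this.div_const _) ?_).const_add _
  simp [div_self hgz]

theorem IsCConvex.hasContinuousLogs {E : Type*} [NormedAddCommGroup E] [NormedSpace ℂ E]
    {D : Set E} (hD : IsCConvex D) (hO : IsOpen D) (hne : D.Nonempty) : HasContinuousLogs D := by
  intro g hg hg0
  obtain ⟨x₀, hx₀⟩ := hne
  set S : E → Set ℂ := fun v ↦ {t | x₀ + t • v ∈ D} with hS
  have hcont : ∀ v : E, Continuous fun t : ℂ ↦ x₀ + t • v := fun v ↦ by fun_prop
  have hSO : ∀ v, IsOpen (S v) := fun v ↦ hO.preimage (hcont v)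
  have hS0 : ∀ v, (0 : ℂ) ∈ S v := fun v ↦ by simp [hS, hx₀]
  have hSC : ∀ v, IsSimplyConnected (S v) := by
    intro v
    by_cases hv : v = 0
    · have : S v = univ := by ext; simp [hS, hv, hx₀]
      rw [this]
      exact isSimplyConnected_univ_complex
    · have hemb : IsEmbedding fun t : ℂ ↦ x₀ + t • v :=
        (Homeomorph.addLeft x₀).isEmbedding.comp (isClosedEmbedding_smul_left hv).isEmbedding
      rw [← hemb.isSimplyConnected_image]
      have : (fun t : ℂ ↦ x₀ + t • v) '' S v = {x | ∃ t : ℂ, x = x₀ + t • v} ∩ D := by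
        ext x
        constructor
        · rintro ⟨t, ht, rfl⟩; exact ⟨⟨t, rfl⟩, ht⟩
        · rintro ⟨⟨t, rfl⟩, ht⟩; exact ⟨t, ht, rfl⟩
      rw [this]
      exact (hD _ ⟨x₀, v, hv, rfl⟩ ⟨x₀, ⟨0, by simp⟩, hx₀⟩).2
  have hlog : ∀ v, ∃ l : ℂ → ℂ, ContinuousOn l (S v) ∧
      (∀ t ∈ S v, Complex.exp (l t) = g (x₀ + t • v)) ∧ l 0 = Complex.log (g x₀) := by
    intro v
    obtain ⟨l, hl, hle⟩ := Complex.exists_continuousOn_eqOn_exp_comp (hSC v) (hSO v)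
      (g := fun t ↦ g (x₀ + t • v))
      (hg.comp (hcont v).continuousOn fun t ht ↦ ht)
      (by rintro ⟨t, ht, h0⟩; exact hg0 _ ht h0)
    have h0 : Complex.exp (l 0) = g x₀ := by simpa using hle (hS0 v)
    refine ⟨fun t ↦ l t + (Complex.log (g x₀) - l 0), hl.add continuousOn_const, fun t ht ↦ ?_,
      by simp⟩
    rw [Complex.exp_add, Complex.exp_sub, Complex.exp_log (hg0 _ hx₀), h0, div_self (hg0 _ hx₀),
      mul_one]
    exact hle ht
  choose l hl hle hl0 using hlog
  have hS1 : ∀ z ∈ D, (1 : ℂ) ∈ S (z - x₀) := fun z hz ↦ by simpa [hS] using hz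
  refine ⟨fun z ↦ l (z - x₀) 1, fun z hz ↦ ?_, fun z hz ↦ by
    simpa using hle _ 1 (hS1 z hz)⟩
  set v := z - x₀ with hv
  obtain ⟨γ, hγ⟩ := (hSC v).isPathConnected.joinedIn 0 (hS0 v) 1 (hS1 z hz)
  -- the values of `g` along nearby slices are uniformly close
  set h : unitInterval × E → E := fun q ↦ x₀ + γ q.1 • (q.2 - x₀) with hh
  have hhc : Continuous h := by fun_prop
  have hW : IsOpen (h ⁻¹' D) := hO.preimage hhc
  have hgc : ContinuousOn (fun q : unitInterval × E ↦ g (h q) / g (x₀ + γ q.1 • v)) (h ⁻¹' D) := by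
    refine (hg.comp hhc.continuousOn fun q hq ↦ hq).div
      (hg.comp (by fun_prop) fun q _ ↦ hγ q.1) fun q _ ↦ hg0 _ (hγ q.1)
  have hV : IsOpen (h ⁻¹' D ∩ (fun q : unitInterval × E ↦ g (h q) / g (x₀ + γ q.1 • v)) ⁻¹'
      Metric.ball 1 1) := hgc.isOpen_inter_preimage hW Metric.isOpen_ball
  obtain ⟨A, N, -, hN, hA, hzN, hAN⟩ := generalized_tube_lemma (s := (univ : Set unitInterval))
    isCompact_univ (t := {z}) isCompact_singleton hV (by
      rintro ⟨s, w⟩ ⟨-, hw⟩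
      rw [show w = z from hw]
      refine ⟨hγ s, ?_⟩
      simp only [mem_preimage, hh, ← hv]
      rw [div_self (hg0 _ (hγ s))]
      exact Metric.mem_ball_self one_pos)
  have key : ∀ w ∈ N, w ∈ D ∧ 0 < (g w / g z).re ∧
      l (w - x₀) 1 = l v 1 + Complex.log (g w / g z) := by
    intro w hw
    have hq : ∀ s : unitInterval, x₀ + γ s • (w - x₀) ∈ D ∧
        0 < (g (x₀ + γ s • (w - x₀)) / g (x₀ + γ s • v)).re := by
      intro s
      have := hAN (show (s, w) ∈ A ×ˢ N from ⟨hA trivial, hw⟩)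
      refine ⟨this.1, re_pos_of_norm_sub_one_lt ?_⟩
      simpa [dist_eq_norm] using this.2
    have h1 := hq 1
    simp only [γ.target, one_smul, add_sub_cancel, hv] at h1
    refine ⟨h1.1, h1.2, ?_⟩
    have := eqOn_of_exp_eqOn (s := (univ : Set unitInterval)) isPreconnected_univ
      (l₁ := fun s ↦ l (w - x₀) (γ s))
      (l₂ := fun s ↦ l v (γ s) + Complex.log (g (x₀ + γ s • (w - x₀)) / g (x₀ + γ s • v)))
      ((hl _).comp γ.continuous.continuousOn fun s _ ↦ (hq s).1)
      (((hl _).comp γ.continuous.continuousOn fun s _ ↦ hγ s).add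
        (ContinuousOn.clog ((hg.comp (by fun_prop) fun s _ ↦ (hq s).1).div
          (hg.comp (by fun_prop) fun s _ ↦ hγ s) fun s _ ↦ hg0 _ (hγ s))
          fun s _ ↦ Or.inl (hq s).2))
      (fun s _ ↦ by
        have hn : g (x₀ + γ s • v) ≠ 0 := hg0 _ (hγ s)
        rw [Complex.exp_add, hle _ _ (hq s).1, hle _ _ (hγ s), Complex.exp_log
          (div_ne_zero (hg0 _ (hq s).1) hn), mul_div_cancel₀ _ hn])
      (mem_univ 0) (by simp [hl0, div_self (hg0 _ hx₀)]) 1 (mem_univ 1)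
    simpa [hv] using this
  have hNz : N ∈ 𝓝 z := hN.mem_nhds (hzN rfl)
  refine ContinuousAt.continuousWithinAt ?_
  have : (fun w ↦ l (w - x₀) 1) =ᶠ[𝓝 z] fun w ↦ l v 1 + Complex.log (g w / g z) := by
    filter_upwards [hNz] with w hw using (key w hw).2.2
  refine ContinuousAt.congr ?_ this.symm
  refine continuousAt_const.add (((hg.continuousAt (hO.mem_nhds hz)).div_const _).clog ?_)
  exact Or.inl (key z (hzN rfl)).2.1

/-- The image of an open set with continuous logarithms under a continuous open map all
of whose fibres are preconnected has continuous logarithms. -/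
theorem HasContinuousLogs.image {X Y : Type*} [TopologicalSpace X] [TopologicalSpace Y]
    {D : Set X} (hD : HasContinuousLogs D)
    (hO : IsOpen D) (hne : D.Nonempty) {f : X → Y} (hf : Continuous f) (hfo : IsOpenMap f)
    (hfib : ∀ x ∈ D, IsPreconnected (D ∩ f ⁻¹' {f x})) : HasContinuousLogs (f '' D) := by
  intro g hg hg0
  have : Nonempty X := ⟨hne.some⟩
  obtain ⟨l, hl, hle⟩ := hD (g ∘ f) (hg.comp hf.continuousOn (mapsTo_image f D))
    fun z hz ↦ hg0 _ (mem_image_of_mem f hz)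
  have hconst : ∀ x ∈ D, ∀ y ∈ D, f x = f y → l x = l y := by
    intro x hx y hy hxy
    refine eqOn_of_exp_eqOn (hfib x hx) (hl.mono inter_subset_left)
      (continuousOn_const (c := l y)) (fun w hw ↦ ?_) (a := y) ⟨hy, hxy.symm⟩ rfl x ⟨hx, rfl⟩
    rw [hle w hw.1, hle y hy]
    simp only [Function.comp, show f w = f x from hw.2, hxy]
  choose! σ hσD hσ using fun y (hy : y ∈ f '' D) ↦ hy
  refine ⟨l ∘ σ, ?_, fun y hy ↦ ?_⟩
  · rintro _ ⟨x, hx, rfl⟩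
    refine ContinuousAt.continuousWithinAt fun U hU ↦ ?_
    have h1 : l (σ (f x)) = l x :=
      hconst _ (hσD _ ⟨x, hx, rfl⟩) _ hx (hσ _ ⟨x, hx, rfl⟩)
    rw [Function.comp, h1] at hU
    have h2 := (hl.continuousAt (hO.mem_nhds hx)) hU
    change (l ∘ σ) ⁻¹' U ∈ 𝓝 (f x)
    filter_upwards [hfo.image_mem_nhds (inter_mem h2 (hO.mem_nhds hx))]
    rintro _ ⟨w, ⟨hw, hwD⟩, rfl⟩
    have : l (σ (f w)) = l w := hconst _ (hσD _ ⟨w, hwD, rfl⟩) _ hwD (hσ _ ⟨w, hwD, rfl⟩)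
    simpa only [mem_preimage, Function.comp, this] using hw
  · rw [Function.comp, hle _ (hσD y hy), Function.comp, hσ y hy]

/-- A zero-free continuous function on the plane cannot agree with `z - a` on a circle
around `a`. -/
theorem not_eq_sub_on_circle {g : ℂ → ℂ} (hg : Continuous g) (h0 : ∀ z, g z ≠ 0) {a : ℂ} {R : ℝ}
    (hR : 0 < R) (h : ∀ z, ‖z - a‖ = R → g z = z - a) : False := by
  obtain ⟨l, hl, hle⟩ := Complex.exists_continuousOn_eqOn_exp_comp isSimplyConnected_univ_complex
    isOpen_univ hg.continuousOn (by rintro ⟨z, -, hz⟩; exact h0 z hz)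
  rw [continuousOn_univ] at hl
  have hle' : ∀ z, Complex.exp (l z) = g z := fun z ↦ hle (mem_univ z)
  have hR' : (R : ℂ) ≠ 0 := by exact_mod_cast hR.ne'
  have hval : ∀ θ : ℝ, Complex.exp (l (a + R * Complex.exp (θ * Complex.I))) =
      R * Complex.exp (θ * Complex.I) := by
    intro θ
    rw [hle', h]
    · ring
    · simp [Complex.norm_exp_ofReal_mul_I, abs_of_pos hR]
  have key := eqOn_of_exp_eqOn (s := (univ : Set ℝ)) isPreconnected_univ
    (l₁ := fun θ : ℝ ↦ l (a + R * Complex.exp (θ * Complex.I)))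
    (l₂ := fun θ : ℝ ↦ l (a + R) + θ * Complex.I)
    (Continuous.continuousOn (by fun_prop)) (Continuous.continuousOn (by fun_prop))
    (fun θ _ ↦ by
      have := hval 0
      simp only [Complex.ofReal_zero, zero_mul, Complex.exp_zero, mul_one] at this
      rw [hval, Complex.exp_add, this])
    (mem_univ 0) (by simp) (2 * Real.pi) (mem_univ _)
  simp [Real.pi_ne_zero] at key

/-- The complement of a bounded open planar set with continuous logarithms has no nonempty
compact relatively open part. -/
theorem HasContinuousLogs.not_isClosed_compl_diff {G : Set ℂ} (hG : HasContinuousLogs G)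
    (hO : IsOpen G) (hB : Bornology.IsBounded G) {K : Set ℂ} (hK : IsCompact K)
    (hne : K.Nonempty) (hKG : Disjoint K G) : ¬ IsClosed (Gᶜ \ K) := by
  intro hM
  obtain ⟨a, ha⟩ := hne
  have haG : a ∉ G := disjoint_left.1 hKG ha
  obtain ⟨L, hL, hLe⟩ := hG (fun z ↦ z - a) (by fun_prop) fun z hz h ↦
    haG (by rwa [← sub_eq_zero.1 h])
  obtain ⟨χ, h0, h1, -⟩ := exists_continuous_zero_one_of_isClosed hK.isClosed hM
    (disjoint_left.2 fun z hz h ↦ h.2 hz)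
  set ψ : ℂ → ℝ := fun z ↦ max 0 (min 1 (3 * χ z - 1)) with hψ
  have hψc : Continuous ψ := by fun_prop
  classical
  set g : ℂ → ℂ := G.piecewise (fun z ↦ Complex.exp (ψ z * L z))
    (fun z ↦ if z ∈ K then 1 else z - a) with hg
  have hcov : ∀ z, z ∈ G ∨ z ∈ K ∨ z ∈ Gᶜ \ K := by
    intro z
    by_cases hz : z ∈ G
    · exact Or.inl hz
    · by_cases hzK : z ∈ K
      · exact Or.inr (Or.inl hzK)
      · exact Or.inr (Or.inr ⟨hz, hzK⟩)
  have hgM : ∀ z ∈ Gᶜ \ K, g z = z - a := fun z hz ↦ by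
    rw [hg, piecewise_eq_of_notMem _ _ _ hz.1, if_neg hz.2]
  have hgK : ∀ z ∈ K, g z = 1 := fun z hz ↦ by
    rw [hg, piecewise_eq_of_notMem _ _ _ (disjoint_left.1 hKG hz), if_pos hz]
  have hgG : ∀ z ∈ G, g z = Complex.exp (ψ z * L z) := fun z hz ↦ by
    rw [hg, piecewise_eq_of_mem _ _ _ hz]
  have hgc : Continuous g := by
    rw [continuous_iff_continuousAt]
    intro z
    rcases hcov z with hz | hz | hz
    · have : ContinuousAt (fun z ↦ Complex.exp (ψ z * L z)) z := by
        have := hL.continuousAt (hO.mem_nhds hz)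
        fun_prop
      refine this.congr ?_
      filter_upwards [hO.mem_nhds hz] with w hw using (hgG w hw).symm
    · refine (continuousAt_const (y := (1 : ℂ))).congr ?_
      have hlt : ∀ᶠ w in 𝓝 z, χ w < 1 / 3 := by
        refine χ.continuous.continuousAt.eventually (gt_mem_nhds ?_)
        rw [h0 hz]; norm_num
      filter_upwards [hlt] with w hw
      rcases hcov w with hw' | hw' | hw'
      · have : ψ w = 0 := by
          rw [hψ]
          exact max_eq_left ((min_le_right _ _).trans (by linarith))
        rw [hgG w hw', this]; simp
      · rw [hgK w hw']
      · have := h1 hw'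
        simp at this
        linarith
    · have : ContinuousAt (fun z ↦ z - a) z := by fun_prop
      refine this.congr ?_
      have hlt : ∀ᶠ w in 𝓝 z, 2 / 3 < χ w := by
        refine χ.continuous.continuousAt.eventually (lt_mem_nhds ?_)
        rw [h1 hz]; norm_num
      filter_upwards [hlt] with w hw
      rcases hcov w with hw' | hw' | hw'
      · have : ψ w = 1 := by
          rw [hψ]
          simp only
          rw [min_eq_left (by linarith)]; norm_num
        rw [hgG w hw', this, ← hLe w hw']; simp
      · have := h0 hw'
        simp at this
        linarith
      · rw [hgM w hw']
  obtain ⟨R, hR⟩ := (hB.union hK.isBounded).subset_ball a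
  have hRpos : 0 < R := by
    have := hR (Or.inr ha)
    simpa using this
  refine not_eq_sub_on_circle hgc (fun z ↦ ?_) hRpos (a := a) fun z hz ↦ hgM z ⟨?_, ?_⟩
  · rcases hcov z with hz | hz | hz
    · rw [hgG z hz]; exact Complex.exp_ne_zero _
    · rw [hgK z hz]; exact one_ne_zero
    · rw [hgM z hz, sub_ne_zero]
      rintro rfl
      exact hz.2 ha
  · intro hzG
    have := hR (Or.inl hzG)
    rw [Metric.mem_ball, dist_eq_norm] at this
    linarith
  · intro hzK
    have := hR (Or.inr hzK)
    rw [Metric.mem_ball, dist_eq_norm] at this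
    linarith

/-- If `c` lies outside a bounded planar domain `G` with continuous logarithms, then some other
point `q` at a prescribed small distance of `c` outside `G` is such that `log ((z - c) / (z - q))`
has a branch on `G` that is the principal one away from `c`. -/
theorem HasContinuousLogs.exists_log_div_eq_principal {G : Set ℂ} (hG : HasContinuousLogs G)
    (hO : IsOpen G) (hC : IsConnected G) (hB : Bornology.IsBounded G) {c : ℂ} (hc : c ∉ G)
    {r : ℝ} (hr : 0 < r) {z₀ : ℂ} (hz₀ : z₀ ∈ G) (hz₀r : 4 * r ≤ ‖z₀ - c‖) :
    ∃ q ∉ G, ‖q - c‖ = r ∧ ∃ L : ℂ → ℂ, ContinuousOn L G ∧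
      (∀ z ∈ G, Complex.exp (L z) = (z - c) / (z - q)) ∧
      ∀ z ∈ G, 4 * r ≤ ‖z - c‖ → L z = Complex.log ((z - c) / (z - q)) := by
  set X : Set ℂ := Gᶜ ∩ Metric.closedBall c r with hX
  have hXc : IsClosed X := hO.isClosed_compl.inter Metric.isClosed_closedBall
  have hsub : ∀ {a z : ℂ}, a ∉ G → z ∈ G → z - a ≠ 0 := fun ha hz h ↦
    ha (by rwa [← sub_eq_zero.1 h])
  have hbr : ∀ a : ℂ, ∃ l : ℂ → ℂ, a ∉ G → ContinuousOn l G ∧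
      (∀ z ∈ G, Complex.exp (l z) = (z - c) / (z - a)) ∧
      l z₀ = Complex.log ((z₀ - c) / (z₀ - a)) := by
    intro a
    by_cases ha : a ∈ G
    · exact ⟨0, fun h ↦ absurd ha h⟩
    obtain ⟨l, hl, hle⟩ := hG (fun z ↦ (z - c) / (z - a))
      (ContinuousOn.div (by fun_prop) (by fun_prop) fun z hz ↦ hsub ha hz)
      fun z hz ↦ div_ne_zero (hsub hc hz) (hsub ha hz)
    refine ⟨fun z ↦ l z + (Complex.log ((z₀ - c) / (z₀ - a)) - l z₀), fun _ ↦
      ⟨hl.add continuousOn_const, fun z hz ↦ ?_, by ring⟩⟩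
    have h0 := div_ne_zero (hsub hc hz₀) (hsub ha hz₀)
    rw [Complex.exp_add, Complex.exp_sub, Complex.exp_log h0, hle z₀ hz₀, hle z hz, div_self h0,
      mul_one]
  choose l hl using hbr
  have hfar : ∀ {a z : ℂ}, a ∈ X → 4 * r ≤ ‖z - c‖ → 3 * r ≤ ‖z - a‖ ∧
      0 < ((z - c) / (z - a)).re := by
    intro a z ha hz
    have h1 : ‖a - c‖ ≤ r := by simpa [dist_eq_norm] using ha.2
    have h2 : 3 * r ≤ ‖z - a‖ := by
      have := norm_sub_le_norm_sub_add_norm_sub z a c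
      linarith
    refine ⟨h2, re_pos_of_norm_sub_one_lt ?_⟩
    have h3 : z - a ≠ 0 := norm_pos_iff.1 (by linarith)
    rw [div_sub_one h3, norm_div, div_lt_one (by linarith), show z - c - (z - a) = a - c by ring]
    linarith
  set P : ℂ → ℂ → ℂ := fun a z ↦ Complex.log ((z - c) / (z - a)) with hP
  have hgap : ∀ z ∈ G, 4 * r ≤ ‖z - c‖ → ∃ ε > 0, ∀ a ∈ X, ∀ b ∈ X, ‖a - b‖ < ε →
      l a z = P a z → l b z = P b z := by
    intro z hz hzr
    obtain ⟨γ, hγ⟩ := (hO.isConnected_iff_isPathConnected.1 hC).joinedIn z₀ hz₀ z hz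
    have hsubG : range γ ⊆ G := range_subset_iff.2 hγ
    obtain ⟨ε, hε, hεG⟩ := (isCompact_range γ.continuous).exists_thickening_subset_open hO hsubG
    refine ⟨min ε r, lt_min hε hr, fun a ha b hb hab hPa ↦ ?_⟩
    have hadd : ∀ w ∈ G, 4 * r ≤ ‖w - c‖ →
        P b w = P a w + Complex.log ((w - a) / (w - b)) := by
      intro w hw hwr
      have h3 := (hfar hb hwr).1
      have h4 : w - b ≠ 0 := hsub hb.1 hw
      have h5 : w - a ≠ 0 := hsub ha.1 hw
      rw [hP]
      simp only
      rw [← log_mul_of_re_pos (hfar ha hwr).2, div_mul_div_cancel₀ h5]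
      refine re_pos_of_norm_sub_one_lt ?_
      rw [div_sub_one h4, norm_div, div_lt_one (by linarith), show w - a - (w - b) = b - a by ring,
        norm_sub_rev]
      linarith [hab.trans_le (min_le_right _ _)]
    have hre : ∀ w ∈ range γ, 0 < ((w - a) / (w - b)).re := by
      intro w hw
      have h4 : w - b ≠ 0 := hsub hb.1 (hsubG hw)
      refine re_pos_of_norm_sub_one_lt ?_
      rw [div_sub_one h4, norm_div, div_lt_one (norm_pos_iff.2 h4),
        show w - a - (w - b) = b - a by ring, norm_sub_rev]
      refine (hab.trans_le (min_le_left _ _)).trans_le (not_lt.1 fun hlt ↦ hb.1 (hεG ?_))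
      rw [Metric.mem_thickening_iff]
      exact ⟨w, hw, by rwa [dist_comm, dist_eq_norm]⟩
    have key := eqOn_of_exp_eqOn (s := range γ)
      (isPreconnected_range γ.continuous)
      (l₁ := l b) (l₂ := fun w ↦ l a w + Complex.log ((w - a) / (w - b)))
      ((hl b hb.1).1.mono hsubG) (((hl a ha.1).1.mono hsubG).add (ContinuousOn.clog
        (ContinuousOn.div (by fun_prop) (by fun_prop) fun w hw ↦ hsub hb.1 (hsubG hw))
        fun w hw ↦ Or.inl (hre w hw)))
      (fun w hw ↦ by
        have h4 : w - b ≠ 0 := hsub hb.1 (hsubG hw)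
        have h5 : w - a ≠ 0 := hsub ha.1 (hsubG hw)
        rw [(hl b hb.1).2.1 w (hsubG hw), Complex.exp_add, (hl a ha.1).2.1 w (hsubG hw),
          Complex.exp_log (div_ne_zero h5 h4), div_mul_div_cancel₀ h5])
      ⟨0, γ.source⟩
      (by rw [(hl b hb.1).2.2, (hl a ha.1).2.2]; exact hadd z₀ hz₀ hz₀r) z ⟨1, γ.target⟩
    rw [key, hPa, hadd z hz hzr]
  set F : Set ℂ := {z | z ∈ G ∧ 4 * r ≤ ‖z - c‖} with hF
  set A : F → Set ℂ := fun z ↦ {a | a ∈ X ∧ l a z = P a z} with hA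
  have hAc : ∀ z, IsClosed (A z) := by
    intro z
    obtain ⟨ε, hε, hgapz⟩ := hgap z z.2.1 z.2.2
    refine isClosed_of_closure_subset fun a ha ↦ ?_
    have haX : a ∈ X := hXc.closure_subset_iff.2 (fun w hw ↦ hw.1) ha
    obtain ⟨b, hb, hab⟩ := Metric.mem_closure_iff.1 ha ε hε
    exact ⟨haX, hgapz b hb.1 a haX (by rwa [norm_sub_rev, ← dist_eq_norm]) hb.2⟩
  by_contra hcon
  push Not at hcon
  have hempty : (Gᶜ ∩ Metric.sphere c r) ∩ ⋂ z, A z = ∅ := by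
    rw [eq_empty_iff_forall_notMem]
    rintro q ⟨⟨hqG, hqr⟩, hqA⟩
    obtain ⟨z, hz, hzr, hne⟩ := hcon q hqG (by simpa [dist_eq_norm] using hqr) (l q)
      (hl q hqG).1 (hl q hqG).2.1
    exact hne (mem_iInter.1 hqA ⟨z, hz, hzr⟩).2
  obtain ⟨u, hu⟩ := ((isCompact_sphere c r).inter_left hO.isClosed_compl).elim_finite_subfamily_closed
    A hAc hempty
  have hcX : c ∈ X := ⟨hc, by simp [hr.le]⟩
  refine hG.not_isClosed_compl_diff hO hB (K := X ∩ ⋂ z ∈ u, A z)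
    (((isCompact_closedBall c r).inter_left hO.isClosed_compl).inter_right
      (isClosed_biInter fun z _ ↦ hAc z))
    ⟨c, hcX, ?_⟩ (disjoint_left.2 fun z hz ↦ hz.1.1) ?_
  · refine mem_iInter₂.2 fun z _ ↦ ⟨hcX, ?_⟩
    have := eqOn_of_exp_eqOn hC.isPreconnected (hl c hc).1 (continuousOn_const (c := (0 : ℂ)))
      (fun w hw ↦ by rw [(hl c hc).2.1 w hw, div_self (hsub hc hw), Complex.exp_zero]) hz₀
      (by rw [(hl c hc).2.2, div_self (hsub hc hz₀), Complex.log_one]) z z.2.1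
    rw [this, hP]
    simp only
    rw [div_self (hsub hc z.2.1), Complex.log_one]
  · refine isClosed_of_closure_subset fun x hx ↦ ?_
    have hxG : x ∈ Gᶜ := hO.isClosed_compl.closure_subset_iff.2 (fun w hw ↦ hw.1) hx
    refine ⟨hxG, fun hxK ↦ ?_⟩
    have hxr : dist x c < r := by
      refine lt_of_le_of_ne hxK.1.2 fun h ↦ ?_
      have : x ∈ (Gᶜ ∩ Metric.sphere c r) ∩ ⋂ z ∈ u, A z := ⟨⟨hxG, h⟩, hxK.2⟩
      rw [hu] at this
      exact this
    have h1 : ∀ᶠ w in 𝓝 x, ∀ z ∈ u, w ∈ X → w ∈ A z := by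
      rw [Filter.eventually_all_finset]
      intro z hz
      obtain ⟨ε, hε, hgapz⟩ := hgap z z.2.1 z.2.2
      filter_upwards [Metric.ball_mem_nhds x hε] with w hw hwX
      exact ⟨hwX, hgapz x hxK.1 w hwX (by rwa [norm_sub_rev, ← dist_eq_norm])
        (mem_iInter₂.1 hxK.2 z hz).2⟩
    have h2 : ∀ᶠ w in 𝓝 x, w ∈ Metric.ball c r := Metric.isOpen_ball.mem_nhds hxr
    obtain ⟨w, ⟨hw1, hw2⟩, hwG, hwK⟩ :=
      ((mem_closure_iff_frequently.1 hx).and_eventually (h1.and h2)).exists.imp fun w h ↦ h.symm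
    have hwX : w ∈ X := ⟨hwG, Metric.ball_subset_closedBall hw2⟩
    exact hwK ⟨hwX, mem_iInter₂.2 fun z hz ↦ hw1 z hz hwX⟩

/-- A point outside a bounded planar domain with continuous logarithms admits uniformly bounded
holomorphic functions tending to `1` at the point and small away from it. -/
theorem HasContinuousLogs.exists_localized {G : Set ℂ} (hG : HasContinuousLogs G)
    (hO : IsOpen G) (hC : IsConnected G) (hB : Bornology.IsBounded G) {c : ℂ} (hc : c ∉ G)
    {ρ : ℝ} (hρ : 0 < ρ) :
    ∃ F : ℂ → ℂ, DifferentiableOn ℂ F G ∧ (∀ z ∈ G, ‖F z‖ ≤ 64) ∧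
      Tendsto F (𝓝[G] c) (𝓝 1) ∧ ∀ z ∈ G, ρ ≤ ‖z - c‖ → ‖F z‖ ≤ 1 / 4 := by
  obtain ⟨z₀, hz₀⟩ := hC.nonempty
  have hsub : ∀ {a z : ℂ}, a ∉ G → z ∈ G → z - a ≠ 0 := fun ha hz h ↦
    ha (by rwa [← sub_eq_zero.1 h])
  set r : ℝ := min ρ ‖z₀ - c‖ / 4 with hr
  have hr0 : 0 < r := div_pos (lt_min hρ (norm_pos_iff.2 (hsub hc hz₀))) (by norm_num)
  have hrρ : 4 * r ≤ ρ := by linarith [min_le_left ρ ‖z₀ - c‖]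
  obtain ⟨q, hq, hqr, L, hL, hLe, hLP⟩ := hG.exists_log_div_eq_principal hO hC hB hc hr0 hz₀
    (by linarith [min_le_right ρ ‖z₀ - c‖])
  have hLd : DifferentiableOn ℂ L G := by
    refine differentiableOn_of_exp_eq hO (g := fun z ↦ (z - c) / (z - q)) ?_ hL hLe
    exact DifferentiableOn.div (by fun_prop) (by fun_prop) fun z hz ↦ hsub hq hz
  set τ : ℂ := 2 * Real.pi * Complex.I with hτ
  have hτn : ‖τ‖ = 2 * Real.pi := by
    simp [hτ, abs_of_pos Real.pi_pos]
  have hpi := Real.pi_gt_three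
  have hpi' := Real.pi_lt_d2
  have hexp : ∀ z, Complex.exp (L z - τ) = Complex.exp (L z) := fun z ↦ by
    rw [Complex.exp_sub, hτ, Complex.exp_two_pi_mul_I, div_one]
  have hfar : ∀ z ∈ G, 4 * r ≤ ‖z - c‖ → ‖L z‖ ≤ 1 / 2 := by
    intro z hz hzr
    have h1 : 3 * r ≤ ‖z - q‖ := by
      have := norm_sub_le_norm_sub_add_norm_sub z q c
      linarith
    have h2 : ‖(q - c) / (z - q)‖ ≤ 1 / 3 := by
      rw [norm_div, hqr, div_le_div_iff₀ (by linarith) (by norm_num)]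
      linarith
    have h3 : (z - c) / (z - q) = 1 + (q - c) / (z - q) := by
      field_simp [hsub hq hz]
      ring
    rw [hLP z hz hzr, h3]
    refine (Complex.norm_log_one_add_half_le_self (h2.trans (by norm_num))).trans ?_
    linarith
  have hnear : ∀ z ∈ G, ‖z - c‖ < 4 * r → 1 / 10 ≤ ‖L z - τ‖ := by
    intro z hz hzr
    by_contra! hlt
    have h1 := Complex.norm_exp_sub_one_le (x := L z - τ) (by linarith)
    have h4 := norm_pos_iff.2 (hsub hq hz)
    rw [hexp, hLe z hz, div_sub_one (hsub hq hz), norm_div,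
      show z - c - (z - q) = q - c by ring, hqr, div_le_iff₀ h4] at h1
    have h2 : ‖z - q‖ ≤ ‖z - c‖ + ‖q - c‖ := by
      have := norm_sub_le_norm_sub_add_norm_sub z c q
      rwa [norm_sub_rev c q] at this
    nlinarith
  have hlow : ∀ z ∈ G, 1 / 10 ≤ ‖L z - τ‖ := by
    intro z hz
    rcases lt_or_ge ‖z - c‖ (4 * r) with h | h
    · exact hnear z hz h
    · have := norm_sub_norm_le τ (L z)
      rw [norm_sub_rev τ] at this
      linarith [hfar z hz h]
  have hne : ∀ z ∈ G, L z - τ ≠ 0 := fun z hz ↦ norm_pos_iff.1 (by linarith [hlow z hz])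
  have hF : ∀ z ∈ G, L z / (L z - τ) = 1 + τ / (L z - τ) := fun z hz ↦ by
    field_simp [hne z hz]
    ring
  refine ⟨fun z ↦ L z / (L z - τ), hLd.div (hLd.sub_const _) hne, fun z hz ↦ ?_, ?_,
    fun z hz hzρ ↦ ?_⟩
  · change ‖L z / (L z - τ)‖ ≤ 64
    rw [hF z hz]
    refine (norm_add_le _ _).trans ?_
    have : ‖τ / (L z - τ)‖ ≤ 63 := by
      rw [norm_div, hτn, div_le_iff₀ (by linarith [hlow z hz])]
      linarith [hlow z hz]
    rw [norm_one]
    linarith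
  · have h1 : Tendsto (fun z ↦ Complex.exp (L z)) (𝓝[G] c) (𝓝 0) := by
      have hcq : c - q ≠ 0 := by
        rw [← norm_pos_iff, norm_sub_rev, hqr]; exact hr0
      have h2 : ContinuousAt (fun z ↦ (z - c) / (z - q)) c :=
        ContinuousAt.div (by fun_prop) (by fun_prop) hcq
      have h3 : Tendsto (fun z ↦ (z - c) / (z - q)) (𝓝[G] c) (𝓝 0) := by
        have := h2.tendsto.mono_left (nhdsWithin_le_nhds (s := G))
        simpa using this
      refine h3.congr' ?_
      filter_upwards [self_mem_nhdsWithin] with z hz using (hLe z hz).symm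
    have h2 : Tendsto (fun z ↦ (L z).re) (𝓝[G] c) atBot := by
      rw [← Real.tendsto_exp_comp_nhds_zero]
      simpa [Complex.norm_exp] using h1.norm
    have h3 : Tendsto (fun z ↦ ‖L z - τ‖) (𝓝[G] c) atTop := by
      refine tendsto_atTop_mono (fun z ↦ ?_) (tendsto_neg_atBot_atTop.comp h2)
      have := Complex.abs_re_le_norm (L z - τ)
      have h5 : (L z - τ).re = (L z).re := by simp [hτ]
      rw [h5] at this
      exact (neg_le_abs _).trans this
    have h4 : Tendsto (fun z ↦ 1 + τ / (L z - τ)) (𝓝[G] c) (𝓝 (1 + 0)) := by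
      refine tendsto_const_nhds.add ?_
      rw [tendsto_zero_iff_norm_tendsto_zero]
      simp only [norm_div]
      exact tendsto_const_nhds.div_atTop h3
    rw [add_zero] at h4
    refine h4.congr' ?_
    filter_upwards [self_mem_nhdsWithin] with z hz using (hF z hz).symm
  · have h1 := hfar z hz (hrρ.trans hzρ)
    have h2 := norm_sub_norm_le τ (L z)
    rw [norm_sub_rev τ] at h2
    simp only
    rw [norm_div, div_le_iff₀ (by linarith)]
    linarith

/-- A planar open set carrying uniformly bounded holomorphic functions which tend to `1` at `c`
and are small away from `c` carries a holomorphic function peaking at `c`. -/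
theorem exists_peak_of_localized {G : Set ℂ} (hO : IsOpen G) {c : ℂ} (hc : c ∉ G)
    (h : ∀ ρ : ℝ, 0 < ρ → ∃ F : ℂ → ℂ, DifferentiableOn ℂ F G ∧ (∀ z ∈ G, ‖F z‖ ≤ 64) ∧
      Tendsto F (𝓝[G] c) (𝓝 1) ∧ ∀ z ∈ G, ρ ≤ ‖z - c‖ → ‖F z‖ ≤ 1 / 4) :
    ∃ f : ℂ → ℂ, DifferentiableOn ℂ f G ∧ (∀ z ∈ G, ‖f z‖ < 1) ∧ Tendsto f (𝓝[G] c) (𝓝 1) ∧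
      ∀ ρ : ℝ, 0 < ρ → ∃ b < 1, ∀ z ∈ G, ρ ≤ ‖z - c‖ → ‖f z‖ ≤ b := by
  choose! Φ hΦd hΦb hΦt hΦs using h
  set θ : ℝ := 255 / 256 with hθ
  have hθ0 : (0 : ℝ) ≤ θ := by norm_num [hθ]
  have hθpos : (0 : ℝ) < θ := by norm_num [hθ]
  have hθ1 : θ < 1 := by norm_num [hθ]
  -- scales, decreasing so fast that each function is nearly `1` at all later scales
  obtain ⟨s, hsP, hsr⟩ := exists_seq_of_forall_finset_exists
    (fun x : ℕ × ℝ ↦ 0 < x.2 ∧ x.2 < 1 / ((x.1 : ℝ) + 1))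
    (fun x y ↦ x.1 < y.1 ∧ y.2 < x.2 ∧
      ∀ z ∈ G, ‖z - c‖ < y.2 → ‖Φ x.2 z‖ ≤ 1 + θ ^ y.1 / 4) (by
    intro s hs
    set N : ℕ := s.sup Prod.fst + 1 with hN
    have h1 : ∀ᶠ t in 𝓝[>] (0 : ℝ), ∀ x ∈ s, t < x.2 ∧
        ∀ z ∈ G, ‖z - c‖ < t → ‖Φ x.2 z‖ ≤ 1 + θ ^ N / 4 := by
      rw [Filter.eventually_all_finset]
      intro x hx
      have hx0 := (hs x hx).1
      have h2 : ∀ᶠ z in 𝓝[G] c, ‖Φ x.2 z‖ < 1 + θ ^ N / 4 := by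
        refine (hΦt x.2 hx0).norm.eventually (gt_mem_nhds ?_)
        rw [norm_one]
        have := pow_pos hθpos N
        linarith
      obtain ⟨δ, hδ, hδG⟩ := Metric.mem_nhdsWithin_iff.1 h2
      filter_upwards [Ioo_mem_nhdsGT (lt_min hx0 hδ)] with t ht
      refine ⟨ht.2.trans_le (min_le_left _ _), fun z hz hzt ↦ le_of_lt (hδG ⟨?_, hz⟩)⟩
      rw [Metric.mem_ball, dist_eq_norm]
      exact hzt.trans (ht.2.trans_le (min_le_right _ _))
    obtain ⟨t, ht1, ht2⟩ := (h1.and (Ioo_mem_nhdsGT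
      (show (0 : ℝ) < 1 / ((N : ℝ) + 1) by positivity))).exists
    exact ⟨(N, t), ht2, fun x hx ↦ ⟨Nat.lt_succ_of_le (Finset.le_sup (f := Prod.fst) hx),
      ht1 x hx⟩⟩)
  have hmono : StrictMono fun n ↦ (s n).1 := fun m n hmn ↦ (hsr m n hmn).1
  have hsn : ∀ n, n ≤ (s n).1 := fun n ↦ hmono.le_apply
  have hanti : ∀ m n, m ≤ n → (s n).2 ≤ (s m).2 := fun m n hmn ↦
    hmn.eq_or_lt.elim (fun h ↦ by rw [h]) fun h ↦ (hsr m n h).2.1.le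
  have hsmall : ∀ ρ : ℝ, 0 < ρ → ∃ k, (s (k + 1)).2 ≤ ρ := by
    intro ρ hρ
    obtain ⟨k, hk⟩ := exists_nat_one_div_lt hρ
    refine ⟨k, ((hsP (k + 1)).2.le.trans ?_).trans hk.le⟩
    have := hsn (k + 1)
    have h2 : (k : ℝ) ≤ (s (k + 1)).1 := by exact_mod_cast (Nat.le_succ k).trans this
    exact one_div_le_one_div_of_le (by positivity) (by linarith)
  set T : ℕ → ℂ → ℂ := fun j z ↦ ((θ ^ j / 256 : ℝ) : ℂ) * Φ (s j).2 z with hT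
  have hgeo : Summable fun j : ℕ ↦ θ ^ j := summable_geometric_of_lt_one hθ0 hθ1
  have hgeo' : ∑' j : ℕ, θ ^ j = 256 := by
    rw [tsum_geometric_of_lt_one hθ0 hθ1, hθ]; norm_num
  have hTn : ∀ j z, ‖T j z‖ = θ ^ j / 256 * ‖Φ (s j).2 z‖ := fun j z ↦ by
    rw [hT]
    simp only
    rw [norm_mul, Complex.norm_real, Real.norm_of_nonneg (by positivity)]
  have hTb : ∀ j, ∀ z ∈ G, ‖T j z‖ ≤ θ ^ j / 4 := by
    intro j z hz
    rw [hTn]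
    have h1 := hΦb (s j).2 (hsP j).1 z hz
    have h2 := pow_pos hθpos j
    nlinarith
  have hbsum : Summable fun j : ℕ ↦ θ ^ j / 4 := hgeo.div_const 4
  set f : ℂ → ℂ := fun z ↦ ∑' j, T j z with hf
  have hbound : ∀ k, ∀ z ∈ G, (s (k + 1)).2 ≤ ‖z - c‖ → ‖f z‖ ≤ 1 - θ ^ k / 4 := by
    intro K z hz hK
    classical
    have hex : ∃ k, (s (k + 1)).2 ≤ ‖z - c‖ := ⟨K, hK⟩
    obtain ⟨k, hk, hkK, hkmin⟩ : ∃ k, (s (k + 1)).2 ≤ ‖z - c‖ ∧ k ≤ K ∧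
        ∀ j < k, ‖z - c‖ < (s k).2 := by
      refine ⟨Nat.find hex, Nat.find_spec hex, Nat.find_min' hex hK, fun j hj ↦ ?_⟩
      have := Nat.find_min hex (m := Nat.find hex - 1) (by omega)
      rw [Nat.sub_add_cancel (by omega)] at this
      exact not_le.1 this
    have hsT : Summable fun j ↦ T j z := Summable.of_norm_bounded hbsum fun j ↦ hTb j z hz
    have h1 : ∀ j ∈ Finset.range k, ‖T j z‖ ≤ θ ^ j / 256 * (1 + θ ^ k / 4) := by
      intro j hj
      have hjk := Finset.mem_range.1 hj
      rw [hTn]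
      refine mul_le_mul_of_nonneg_left ?_ (by positivity)
      refine ((hsr j k hjk).2.2 z hz (hkmin j hjk)).trans ?_
      have := pow_le_pow_of_le_one hθ0 hθ1.le (hsn k)
      linarith
    have h2 : ∀ j, ‖T (j + (k + 1)) z‖ ≤ θ ^ j * (θ ^ (k + 1) / 1024) := by
      intro j
      rw [hTn]
      have := hΦs (s (j + (k + 1))).2 (hsP _).1 z hz ((hanti (k + 1) _ (by omega)).trans hk)
      have h3 : θ ^ (j + (k + 1)) = θ ^ j * θ ^ (k + 1) := pow_add _ _ _
      have h4 : 0 < θ ^ j * θ ^ (k + 1) := by positivity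
      rw [h3]
      nlinarith
    have h3 : ‖∑' j, T (j + (k + 1)) z‖ ≤ 256 * (θ ^ (k + 1) / 1024) := by
      refine tsum_of_norm_bounded ?_ h2
      have := hgeo.hasSum
      rw [hgeo'] at this
      exact this.mul_right _
    have h4 : ‖∑ j ∈ Finset.range k, T j z‖ ≤ (1 - θ ^ k) * (1 + θ ^ k / 4) := by
      refine (norm_sum_le_of_le _ h1).trans_eq ?_
      rw [← Finset.sum_mul, ← Finset.sum_div, geom_sum_eq hθ1.ne]
      congr 1
      rw [hθ]
      ring
    have h5 := hTb k z hz
    have h6 : f z = ∑ j ∈ Finset.range k, T j z + T k z + ∑' j, T (j + (k + 1)) z := by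
      rw [hf, ← Finset.sum_range_succ]
      exact (hsT.sum_add_tsum_nat_add (k + 1)).symm
    have h7 : θ ^ (k + 1) ≤ θ ^ k := pow_le_pow_of_le_one hθ0 hθ1.le (Nat.le_succ k)
    have h8 : θ ^ K ≤ θ ^ k := pow_le_pow_of_le_one hθ0 hθ1.le hkK
    rw [h6]
    refine (norm_add₃_le).trans ?_
    nlinarith [sq_nonneg (θ ^ k)]
  refine ⟨f, ?_, fun z hz ↦ ?_, ?_, fun ρ hρ ↦ ?_⟩
  · exact Complex.differentiableOn_tsum_of_summable_norm hbsum
      (fun j ↦ (hΦd (s j).2 (hsP j).1).const_mul _) hO hTb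
  · have : 0 < ‖z - c‖ := norm_pos_iff.2 (sub_ne_zero.2 (by rintro rfl; exact hc hz))
    obtain ⟨k, hk⟩ := hsmall _ this
    have h1 := hbound k z hz hk
    have := pow_pos hθpos k
    linarith
  · have h1 : ∑' j : ℕ, ((θ ^ j / 256 : ℝ) : ℂ) = 1 := by
      rw [← Complex.ofReal_tsum, tsum_div_const, hgeo']; norm_num
    rw [← h1]
    refine tendsto_tsum_of_dominated_convergence hbsum (fun j ↦ ?_) ?_
    · have := (hΦt (s j).2 (hsP j).1).const_mul ((θ ^ j / 256 : ℝ) : ℂ)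
      rwa [mul_one] at this
    · filter_upwards [self_mem_nhdsWithin] with z hz j using hTb j z hz
  · obtain ⟨k, hk⟩ := hsmall ρ hρ
    refine ⟨1 - θ ^ k / 4, by linarith [pow_pos hθpos k], fun z hz hzρ ↦
      hbound k z hz (hk.trans hzρ)⟩

/-- A hyperplane section of the closure of a ℂ-convex set having `p` as an isolated point is
reduced to `p`. -/
theorem IsCConvex.eq_of_isolated_in_level {E : Type*} [NormedAddCommGroup E] [NormedSpace ℂ E]
    [ProperSpace E] {D : Set E} (hD : IsCConvex D) (φ : E →L[ℂ] ℂ) {c : ℂ} {p : E} {U : Set E}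
    (hU : IsOpen U) (hpU : p ∈ U) (hp : p ∈ closure D) (hpc : φ p = c)
    (h : ∀ x ∈ closure D, φ x = c → x ∈ U → x = p) : ∀ x ∈ closure D, φ x = c → x = p := by
  intro y hy hyc
  by_contra hyp
  obtain ⟨ε, hε, hεU⟩ := Metric.isOpen_iff.1 hU p hpU
  have hd : 0 < dist y p := dist_pos.2 hyp
  obtain ⟨r, hr0, hr⟩ := exists_between (lt_min hε hd)
  have hrε : r < ε := hr.trans_le (min_le_left _ _)
  have hrd : r < dist y p := hr.trans_le (min_le_right _ _)
  obtain ⟨P, hP, hPt⟩ := mem_closure_iff_seq_limit.1 hp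
  obtain ⟨Y, hY, hYt⟩ := mem_closure_iff_seq_limit.1 hy
  have hev : ∀ᶠ n in atTop, ∃ w ∈ D, dist w p = r ∧
      ‖φ w - φ (P n)‖ * ‖Y n - P n‖ = ‖w - P n‖ * ‖φ (Y n) - φ (P n)‖ := by
    have h1 : ∀ᶠ n in atTop, dist (P n) p < r := by
      have := hPt.dist (tendsto_const_nhds (x := p))
      rw [dist_self] at this
      exact this.eventually (gt_mem_nhds hr0)
    have h2 : ∀ᶠ n in atTop, r < dist (Y n) p :=
      (hYt.dist (tendsto_const_nhds (x := p))).eventually (lt_mem_nhds hrd)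
    filter_upwards [h1, h2] with n hn1 hn2
    have hv : Y n - P n ≠ 0 := fun h0 ↦ by
      rw [sub_eq_zero.1 h0] at hn2
      exact lt_asymm hn1 hn2
    have hPL : P n ∈ {x | ∃ t : ℂ, x = P n + t • (Y n - P n)} ∩ D := ⟨⟨0, by simp⟩, hP n⟩
    have hYL : Y n ∈ {x | ∃ t : ℂ, x = P n + t • (Y n - P n)} ∩ D := ⟨⟨1, by simp⟩, hY n⟩
    have hcon := (hD _ ⟨P n, Y n - P n, hv, rfl⟩ ⟨_, hPL⟩).1.isPreconnected
    obtain ⟨w, ⟨⟨t, rfl⟩, hwD⟩, hw⟩ := hcon.intermediate_value hPL hYL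
      (f := fun x ↦ dist x p) (by fun_prop) ⟨hn1.le, hn2.le⟩
    refine ⟨_, hwD, hw, ?_⟩
    simp only [map_add, map_smul, map_sub, smul_eq_mul, add_sub_cancel_left, norm_mul, norm_smul]
    ring
  obtain ⟨N, hN⟩ := eventually_atTop.1 hev
  choose! W hWD hWr hW using hN
  have hshift : Tendsto (fun n ↦ n + N) atTop atTop := tendsto_add_atTop_nat N
  obtain ⟨w, hw, k, hk, hkt⟩ := (isCompact_sphere p r).tendsto_subseq
    (x := fun n ↦ W (n + N)) fun n ↦ hWr _ (Nat.le_add_left _ _)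
  have hPk := hPt.comp (hshift.comp hk.tendsto_atTop)
  have hYk := hYt.comp (hshift.comp hk.tendsto_atTop)
  have hwcl : w ∈ closure D :=
    mem_closure_of_tendsto hkt (Eventually.of_forall fun n ↦ hWD _ (Nat.le_add_left _ _))
  have hφt : ∀ {u : ℕ → E} {x : E}, Tendsto u atTop (𝓝 x) →
      Tendsto (fun n ↦ φ (u n)) atTop (𝓝 (φ x)) := fun hu ↦ (φ.continuous.tendsto _).comp hu
  have hl := (((hφt hkt).sub (hφt hPk)).norm.mul (hYk.sub hPk).norm)
  have hrt := ((hkt.sub hPk).norm.mul ((hφt hYk).sub (hφt hPk)).norm)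
  have heq := tendsto_nhds_unique_of_eventuallyEq hl hrt
    (Eventually.of_forall fun n ↦ hW _ (Nat.le_add_left _ _))
  rw [hyc, hpc, sub_self, norm_zero, mul_zero, ← dist_eq_norm y p] at heq
  have hwc : φ w = c :=
    sub_eq_zero.1 (norm_eq_zero.1 ((mul_eq_zero.1 heq).resolve_right hd.ne'))
  have hwr : dist w p = r := hw
  have := h w hwcl hwc (hεU (by rw [Metric.mem_ball, hwr]; exact hrε))
  rw [this, dist_self] at hwr
  exact hr0.ne hwr

theorem IsCConvex.isPreconnected_inter_fiber {E : Type*} [NormedAddCommGroup E]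
    [NormedSpace ℂ E] {D : Set E} (hD : IsCConvex D) (φ : E →L[ℂ] ℂ) (c : ℂ) :
    IsPreconnected (D ∩ φ ⁻¹' {c}) := by
  refine isPreconnected_of_forall_pair fun y hy z hz ↦ ?_
  by_cases hyz : z - y = 0
  · rw [sub_eq_zero.1 hyz]
    exact ⟨{y}, by simpa using hy, rfl, rfl, isPreconnected_singleton⟩
  · have hyL : y ∈ {x | ∃ t : ℂ, x = y + t • (z - y)} ∩ D := ⟨⟨0, by simp⟩, hy.1⟩
    refine ⟨_, ?_, hyL, ⟨⟨1, by simp⟩, hz.1⟩, (hD _ ⟨y, _, hyz, rfl⟩ ⟨_, hyL⟩).1.isPreconnected⟩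
    rintro _ ⟨⟨t, rfl⟩, hx⟩
    have h1 : φ y = c := hy.2
    have h2 : φ z = c := hz.2
    exact ⟨hx, by simp [h1, h2]⟩

/-- Let `D` be a bounded ℂ-convex domain in ℂⁿ and let `p ∈ ∂D` be an extreme ℂ-convex
boundary point of `D`. Then `p` is a holomorphic peak point of `D`: there is a holomorphic
`f : D → 𝔻` with `f(z) → 1` as `z → p` and `sup {|f z| : z ∈ D \ U} < 1` for every open
neighborhood `U` of `p`. -/
theorem extremeCConvexAt_holomorphic_peak_point {n : ℕ}
    (D : Set (EuclideanSpace ℂ (Fin n)))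
    (hOpen : IsOpen D) (hConn : IsConnected D) (hBdd : Bornology.IsBounded D)
    (hCC : IsCConvex D)
    (p : EuclideanSpace ℂ (Fin n)) (hp : p ∈ frontier D)
    (hext : ExtremeCConvexAt D p) :
    ∃ f : EuclideanSpace ℂ (Fin n) → ℂ,
      DifferentiableOn ℂ f D ∧
      (∀ z ∈ D, ‖f z‖ < 1) ∧
      Filter.Tendsto f (𝓝[D] p) (𝓝 1) ∧
      ∀ U : Set (EuclideanSpace ℂ (Fin n)), IsOpen U → p ∈ U →
        ∃ c : ℝ, c < 1 ∧ ∀ z ∈ D \ U, ‖f z‖ ≤ c := by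
  obtain ⟨_, ⟨φ, c, hφ, rfl⟩, hpc, U, hU, hpU, hUp⟩ := hext
  have hpc' : φ p = c := hpc
  have hglob : ∀ x ∈ closure D, φ x = c → x = p := by
    refine hCC.eq_of_isolated_in_level φ hU hpU hp.1 hpc' fun x hx hxc hxU ↦ ?_
    have : x ∈ ({p} : Set _) := hUp ▸ ⟨⟨hxc, hx⟩, hxU⟩
    exact this
  have hpD : p ∉ D := by
    rw [← hOpen.interior_eq]
    exact hp.2
  have hφo : IsOpenMap φ := φ.isOpenMap_of_ne_zero hφ
  have hcG : c ∉ φ '' D := by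
    rintro ⟨x, hx, hxc⟩
    exact hpD (hglob x (subset_closure hx) hxc ▸ hx)
  have hGO : IsOpen (φ '' D) := hφo D hOpen
  have hlogs : HasContinuousLogs (φ '' D) :=
    (hCC.hasContinuousLogs hOpen hConn.nonempty).image hOpen hConn.nonempty φ.continuous hφo
      fun x _ ↦ hCC.isPreconnected_inter_fiber φ (φ x)
  obtain ⟨f, hfd, hf1, hft, hfb⟩ := exists_peak_of_localized hGO hcG fun ρ hρ ↦
    hlogs.exists_localized hGO (hConn.image φ φ.continuous.continuousOn)
      (φ.lipschitz.isBounded_image hBdd) hcG hρ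
  refine ⟨fun z ↦ f (φ z), hfd.comp φ.differentiable.differentiableOn (mapsTo_image φ D),
    fun z hz ↦ hf1 _ (mem_image_of_mem φ hz), ?_, fun V hV hpV ↦ ?_⟩
  · refine hft.comp (tendsto_nhdsWithin_iff.2 ⟨?_, ?_⟩)
    · rw [← hpc']
      exact φ.continuous.continuousAt.mono_left nhdsWithin_le_nhds
    · filter_upwards [self_mem_nhdsWithin] with z hz using mem_image_of_mem φ hz
  · have hK : IsCompact (closure D \ V) := hBdd.isCompact_closure.diff hV
    obtain ⟨ρ, hρ, hρK⟩ := hK.exists_forall_le' (f := fun z ↦ ‖φ z - c‖) (by fun_prop)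
      (a := 0) fun z hz ↦ norm_pos_iff.2 (sub_ne_zero.2 fun hzc ↦
        hz.2 (hglob z hz.1 hzc ▸ hpV))
    obtain ⟨b, hb, hbz⟩ := hfb ρ hρ
    exact ⟨b, hb, fun z hz ↦ hbz _ (mem_image_of_mem φ hz.1) (hρK z ⟨subset_closure hz.1, hz.2⟩)⟩
end

section
/- Let D be a bounded ℂ-convex domain in ℂⁿ and let p ∈ ∂D. Then p is extreme ℂ-convex if and only if p is globally extreme ℂ-convex. -/
open Set Topology Filter

/-- In a finite-dimensional space, if `H` is a complex affine hyperplane and `D` is ℂ-convex, then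
an isolated point of `H ∩ closure D` is its only point. The lines through points of `D` close to
`p` and `q` meet `D` on every small sphere around `p`, and these intersections accumulate
on `H`. -/
theorem IsCConvex.eq_of_isolated_mem_hyperplane {E : Type*} [NormedAddCommGroup E]
    [NormedSpace ℂ E] [ProperSpace E] {D H U : Set E} (hCC : IsCConvex D)
    (hH : IsComplexAffineHyperplane H) {p q : E} (hU : IsOpen U) (hpU : p ∈ U)
    (hHU : H ∩ closure D ∩ U = {p}) (hpH : p ∈ H) (hpD : p ∈ closure D)
    (hqH : q ∈ H) (hqD : q ∈ closure D) : q = p := by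
  by_contra hne
  obtain ⟨f, c, -, rfl⟩ := hH
  simp only [mem_ofPred_eq] at hpH hqH
  have hd : 0 < dist q p := dist_pos.2 hne
  obtain ⟨r₀, hr₀, hball⟩ := Metric.isOpen_iff.1 hU p hpU
  obtain ⟨r, hr, hrr₀, hrd⟩ : ∃ r : ℝ, 0 < r ∧ r < r₀ ∧ 4 * r ≤ dist q p :=
    ⟨min (r₀ / 2) (dist q p / 4), by positivity,
      (min_le_left _ _).trans_lt (by linarith),
      by linarith [min_le_right (r₀ / 2) (dist q p / 4)]⟩
  have hK : IsCompact (Metric.sphere p r ∩ closure D) :=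
    (isCompact_sphere p r).inter_right isClosed_closure
  have hc : c ∈ closure (f '' (Metric.sphere p r ∩ closure D)) := by
    rw [Metric.mem_closure_iff]
    intro ε hε
    have approx : ∀ w ∈ closure D, f w = c → ∃ x ∈ D, dist x w < r / 2 ∧ ‖f x - c‖ < ε / 3 := by
      intro w hw hfw
      have hnear : ∀ᶠ x in 𝓝 w, dist x w < r / 2 ∧ ‖f x - c‖ < ε / 3 := by
        refine Filter.Eventually.and (Metric.ball_mem_nhds w (half_pos hr)) ?_
        have := f.continuous.continuousAt.eventually
          (Metric.ball_mem_nhds (f w) (show 0 < ε / 3 by positivity))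
        simpa [dist_eq_norm, hfw] using this
      obtain ⟨x, hx, hxD⟩ := mem_closure_iff_nhds.1 hw _ hnear
      exact ⟨x, hxD, hx⟩
    obtain ⟨x, hxD, hxp, hfx⟩ := approx p hpD hpH
    obtain ⟨y, hyD, hyq, hfy⟩ := approx q hqD hqH
    have hyx : 3 * r ≤ dist y x := by
      linarith [dist_triangle4 q y x p, dist_comm q y]
    have hyx₀ : y - x ≠ 0 := sub_ne_zero.2 (dist_pos.1 (by linarith))
    have hpre := (hCC _ ⟨x, y - x, hyx₀, rfl⟩ ⟨x, ⟨0, by simp⟩, hxD⟩).1.isPreconnected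
    obtain ⟨z, ⟨⟨t, rfl⟩, hzD⟩, hzr⟩ := hpre.intermediate_value (f := fun z => dist z p)
      (a := x) (b := y) ⟨⟨0, by simp⟩, hxD⟩ ⟨⟨1, by simp⟩, hyD⟩ (by fun_prop)
      (show r ∈ Icc (dist x p) (dist y p) from
        ⟨by linarith, by linarith [dist_triangle q y p, dist_comm q y]⟩)
    refine ⟨_, ⟨_, ⟨hzr, subset_closure hzD⟩, rfl⟩, ?_⟩
    have ht : ‖t‖ ≤ 1 := by
      have h₁ : ‖t‖ * dist y x ≤ 2 * r := by
        have := dist_triangle_right (x + t • (y - x)) x p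
        rw [dist_self_add_left, norm_smul, ← dist_eq_norm] at this
        simp only at hzr
        linarith
      by_contra! h
      nlinarith
    have hsplit : f (x + t • (y - x)) - c = (f x - c) + t * ((f y - c) - (f x - c)) := by
      simp only [map_add, map_smul, map_sub, smul_eq_mul]
      ring
    rw [dist_comm, dist_eq_norm, hsplit]
    calc ‖(f x - c) + t * ((f y - c) - (f x - c))‖
        ≤ ‖f x - c‖ + ‖t‖ * ‖(f y - c) - (f x - c)‖ :=
          (norm_add_le _ _).trans_eq (by rw [norm_mul])
      _ ≤ ‖f x - c‖ + 1 * (‖f y - c‖ + ‖f x - c‖) := by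
          gcongr
          exact norm_sub_le _ _
      _ < ε := by linarith
  rw [(hK.image f.continuous).isClosed.closure_eq] at hc
  obtain ⟨z, ⟨hzr, hzD⟩, hfz⟩ := hc
  have hzp : z ∈ ({p} : Set E) :=
    hHU ▸ ⟨⟨hfz, hzD⟩, hball (Metric.sphere_subset_ball hrr₀ hzr)⟩
  rw [mem_singleton_iff.1 hzp, Metric.mem_sphere, dist_self] at hzr
  exact hr.ne hzr

/-- Let `D` be a bounded ℂ-convex domain in ℂⁿ and let `p ∈ ∂D`. Then `p` is extreme
ℂ-convex iff `p` is globally extreme ℂ-convex. -/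
theorem extremeCConvexAt_iff_globallyExtremeCConvexAt {n : ℕ}
    (D : Set (EuclideanSpace ℂ (Fin n)))
    (hOpen : IsOpen D) (hConn : IsConnected D) (hBdd : Bornology.IsBounded D)
    (hCC : IsCConvex D)
    (p : EuclideanSpace ℂ (Fin n)) (hp : p ∈ frontier D) :
    ExtremeCConvexAt D p ↔ GloballyExtremeCConvexAt D p := by
  constructor
  · rintro ⟨H, hH, hpH, U, hU, hpU, hHU⟩
    have hpD : p ∈ closure D := frontier_subset_closure hp
    refine ⟨H, hH, hpH, eq_singleton_iff_unique_mem.2 ⟨⟨hpH, hpD⟩, ?_⟩⟩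
    rintro q ⟨hqH, hqD⟩
    exact hCC.eq_of_isolated_mem_hyperplane hH hU hpU hHU hpH hpD hqH hqD
  · rintro ⟨H, hH, hpH, h⟩
    exact ⟨H, hH, hpH, univ, isOpen_univ, mem_univ p, by rw [inter_univ, h]⟩
end

section
/- Let D be a bounded ℂ-convex domain in ℂⁿ and let p ∈ ∂D. Then p is strictly ℂ-convex if and only if p is globally strictly ℂ-convex. -/
open Set Topology Filter

/-- If every complex line meets `D` in a connected set, then a point of `closure D` on a complex
hyperplane `{f = f p}` that is isolated in `closure D ∩ {f = f p}` is the only point of that set: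
lines through points of `D` converging to `p` and to `q` have points of `D` on any small sphere
around `p`, and these accumulate on the hyperplane. -/
theorem IsCConvex.eq_of_isolated {E : Type*} [NormedAddCommGroup E] [NormedSpace ℂ E]
    [ProperSpace E] {D U : Set E} (hD : IsCConvex D) (hU : IsOpen U) {p q : E} (hpU : p ∈ U)
    (f : E →L[ℂ] ℂ) (hiso : ∀ x ∈ U ∩ closure D, f x = f p → x = p)
    (hp : p ∈ closure D) (hq : q ∈ closure D) (hfq : f q = f p) : q = p := by
  by_contra hqp
  have hd : 0 < dist q p := dist_pos.2 hqp
  obtain ⟨ε, hε, hεU⟩ := Metric.isOpen_iff.1 hU p hpU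
  obtain ⟨r, hr, hr'⟩ := exists_between (lt_min hε hd)
  obtain ⟨hrε, hrd⟩ := lt_min_iff.1 hr'
  obtain ⟨a, haD, ha⟩ := mem_closure_iff_seq_limit.1 hp
  obtain ⟨b, hbD, hb⟩ := mem_closure_iff_seq_limit.1 hq
  have hev : ∀ᶠ k in atTop, ∃ c, c ∈ D ∧ c ∈ Metric.sphere p r ∧
      ‖f c - f (a k)‖ * ‖b k - a k‖ = ‖c - a k‖ * ‖f (b k) - f (a k)‖ := by
    have ha' : ∀ᶠ k in atTop, dist (a k) p < r :=
      (ha.dist tendsto_const_nhds).eventually_lt_const (by simpa using hr)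
    have hb' : ∀ᶠ k in atTop, r < dist (b k) p :=
      (hb.dist tendsto_const_nhds).eventually_const_lt hrd
    filter_upwards [ha', hb'] with k hak hbk
    have hab : b k - a k ≠ 0 := fun h => by
      rw [sub_eq_zero.1 h] at hbk
      exact lt_asymm hak hbk
    set L : Set E := {x | ∃ t : ℂ, x = a k + t • (b k - a k)}
    have haL : a k ∈ L := ⟨0, by simp⟩
    have hbL : b k ∈ L := ⟨1, by simp⟩
    have hconn := (hD L ⟨a k, b k - a k, hab, rfl⟩ ⟨a k, haL, haD k⟩).1
    obtain ⟨c, ⟨⟨t, rfl⟩, hcD⟩, hcr⟩ :=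
      hconn.isPreconnected.intermediate_value ⟨haL, haD k⟩ ⟨hbL, hbD k⟩
        (f := fun x => dist x p) (by fun_prop) ⟨hak.le, hbk.le⟩
    refine ⟨_, hcD, hcr, ?_⟩
    simp only [map_add, map_smul, map_sub, add_sub_cancel_left, norm_smul, smul_eq_mul, norm_mul]
    ring
  obtain ⟨c, hc⟩ := hev.choice
  obtain ⟨z, hz, φ, hφ, hcz⟩ := (isCompact_sphere p r).tendsto_subseq'
    (hc.mono fun _ h => h.2.1).frequently
  have hcφ := hφ.tendsto_atTop.eventually hc
  have haφ := ha.comp hφ.tendsto_atTop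
  have hbφ := hb.comp hφ.tendsto_atTop
  have hzD : z ∈ closure D := mem_closure_of_tendsto hcz (hcφ.mono fun _ h => h.1)
  have hlim : ‖f z - f p‖ * ‖q - p‖ = ‖z - p‖ * ‖f q - f p‖ := by
    have hf := f.continuous.tendsto
    refine tendsto_nhds_unique_of_eventuallyEq
      ((((hf z).comp hcz).sub ((hf p).comp haφ)).norm.mul (hbφ.sub haφ).norm)
      ((hcz.sub haφ).norm.mul (((hf q).comp hbφ).sub ((hf p).comp haφ)).norm)
      (hcφ.mono fun _ h => h.2.2)
  have hfz : f z = f p := by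
    simpa [hfq, sub_eq_zero, hqp] using hlim
  have hzU : z ∈ U := hεU (by rwa [Metric.mem_ball, Metric.mem_sphere.1 hz])
  have hzp := hiso z ⟨hzU, hzD⟩ hfz
  rw [Metric.mem_sphere, hzp, dist_self] at hz
  exact hr.ne hz

/-- Let `D` be a bounded ℂ-convex domain in ℂⁿ and let `p ∈ ∂D`. Then `p` is strictly
ℂ-convex iff `p` is globally strictly ℂ-convex. -/
theorem strictlyCConvexAt_iff_globallyStrictlyCConvexAt {n : ℕ}
    (D : Set (EuclideanSpace ℂ (Fin n)))
    (hOpen : IsOpen D) (hConn : IsConnected D) (hBdd : Bornology.IsBounded D)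
    (hCC : IsCConvex D)
    (p : EuclideanSpace ℂ (Fin n)) (hp : p ∈ frontier D) :
    StrictlyCConvexAt D p ↔ GloballyStrictlyCConvexAt D p := by
  constructor
  · rintro ⟨U, hU, hpU, h⟩ H ⟨f, c, hf, rfl⟩ hpH hHD
    have hiso := h _ ⟨f, c, hf, rfl⟩ hpH hHD
    have hpc : p ∈ closure D := frontier_subset_closure hp
    obtain rfl : f p = c := hpH
    refine Subset.antisymm ?_ (singleton_subset_iff.2 ⟨hpc, rfl⟩)
    rintro q ⟨hq, hfq⟩
    refine hCC.eq_of_isolated hU hpU f (fun x hx hfx => ?_) hpc hq hfq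
    exact hiso.subset ⟨hx, hfx⟩
  · intro h
    refine ⟨univ, isOpen_univ, mem_univ p, fun H hH hpH hHD => ?_⟩
    rw [univ_inter]
    exact h H hH hpH hHD
end

section
/- Let D be a bounded ℂ-convex domain in ℂⁿ that is strictly ℂ-convex. Then for every boundary point p ∈ ∂D and every complex affine line ℓ with p ∈ ℓ and ℓ ∩ D = ∅, one has ℓ ∩ cl(D) = {p}. -/
open Set Topology Filter

/-- Every nonempty intersection of `D` with a complex line, written in an affine parameter of the
line, is simply connected. Constant parametrizations are allowed. -/
def HasSimplyConnectedSlices {E : Type*} [NormedAddCommGroup E] [NormedSpace ℂ E]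
    (D : Set E) : Prop :=
  ∀ a v : E, {t : ℂ | a + t • v ∈ D}.Nonempty → IsSimplyConnected {t : ℂ | a + t • v ∈ D}

theorem IsCConvex.hasSimplyConnectedSlices {E : Type*} [NormedAddCommGroup E] [NormedSpace ℂ E]
    {D : Set E} (hD : IsCConvex D) : HasSimplyConnectedSlices D := by
  intro a v hne
  rcases eq_or_ne v 0 with rfl | hv
  · obtain ⟨t, ht⟩ := hne
    have : {t : ℂ | a + t • (0 : E) ∈ D} = univ := by
      ext s
      simpa using ht
    rw [this]
    exact isSimplyConnected_univ_complex
  · have hemb : IsEmbedding fun t : ℂ ↦ a + t • v :=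
      (Homeomorph.addLeft a).isEmbedding.comp (isClosedEmbedding_smul_left hv).isEmbedding
    rw [← hemb.isSimplyConnected_image]
    have himage : (fun t : ℂ ↦ a + t • v) '' {t : ℂ | a + t • v ∈ D} =
        {x | ∃ t : ℂ, x = a + t • v} ∩ D := by
      ext x
      constructor
      · rintro ⟨t, ht, rfl⟩
        exact ⟨⟨t, rfl⟩, ht⟩
      · rintro ⟨⟨t, rfl⟩, ht⟩
        exact ⟨t, ht, rfl⟩
    rw [himage]
    obtain ⟨t, ht⟩ := hne
    exact (hD _ ⟨a, v, hv, rfl⟩ ⟨a + t • v, ⟨t, rfl⟩, ht⟩).2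

theorem HasSimplyConnectedSlices.preimage {E F : Type*} [NormedAddCommGroup E] [NormedSpace ℂ E]
    [NormedAddCommGroup F] [NormedSpace ℂ F] {D : Set E} (hD : HasSimplyConnectedSlices D)
    (p : E) (φ : F →ₗ[ℂ] E) : HasSimplyConnectedSlices {x | p + φ x ∈ D} := by
  intro a v hne
  have h := hD (p + φ a) (φ v)
  simp only [add_assoc, ← map_smul, ← map_add] at h
  exact h hne

theorem HasSimplyConnectedSlices.joinedIn {E : Type*} [NormedAddCommGroup E] [NormedSpace ℂ E]
    {D : Set E} (hD : HasSimplyConnectedSlices D) {x y : E} (hx : x ∈ D) (hy : y ∈ D) :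
    JoinedIn D x y := by
  have hpc := (hD x (y - x) ⟨0, by simpa using hx⟩).isPathConnected
  have h := hpc.joinedIn 0 (by simpa using hx) 1 (by simpa using hy)
  obtain ⟨γ, hγ⟩ := h
  exact ⟨(γ.map (f := fun t : ℂ ↦ x + t • (y - x)) (by fun_prop)).cast (by simp) (by simp), hγ⟩

/-- Two continuous logarithms of the same function on a connected space have the same
increments. -/
theorem sub_eq_sub_of_exp_eq {Y : Type*} [TopologicalSpace Y] [PreconnectedSpace Y] {g₁ g₂ : Y → ℂ}
    (h₁ : Continuous g₁) (h₂ : Continuous g₂) (h : ∀ y, Complex.exp (g₁ y) = Complex.exp (g₂ y))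
    (x y : Y) : g₁ y - g₁ x = g₂ y - g₂ x := by
  have := Complex.isCoveringMap_exp.const_of_comp (h₁.sub h₂)
    (fun a b ↦ by simp [Complex.exp_sub, h, Complex.exp_ne_zero]) x y
  simp only [Pi.sub_apply] at this
  linear_combination -this

/-- Increments of fibrewise continuous logarithms, between two sections that can be joined in the
fibre, depend continuously on the base point. -/
theorem continuousAt_sub_of_exp_eq {X E : Type*} [TopologicalSpace X] [NormedAddCommGroup E]
    [NormedSpace ℝ E] {F : Set (X × E)} (hF : IsOpen F) {f : X × E → ℂ} (hf : ContinuousOn f F)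
    {g : X → E → ℂ} (hg : ∀ x, ContinuousOn (g x) {e | (x, e) ∈ F})
    (hgf : ∀ x e, (x, e) ∈ F → Complex.exp (g x e) = f (x, e)) {x₀ : X} {σ τ : X → E}
    (hσ : ContinuousAt σ x₀) (hτ : ContinuousAt τ x₀)
    (hj : JoinedIn {e | (x₀, e) ∈ F} (σ x₀) (τ x₀)) :
    ContinuousAt (fun x ↦ g x (τ x) - g x (σ x)) x₀ := by
  obtain ⟨γ, hγ⟩ := hj
  let c : X × unitInterval → E := fun q ↦ γ q.2 + (1 - (q.2 : ℝ)) • (σ q.1 - σ x₀) +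
    (q.2 : ℝ) • (τ q.1 - τ x₀)
  have hc0 : ∀ s, c (x₀, s) = γ s := by simp [c]
  have hc : ∀ s, ContinuousAt c (x₀, s) := by
    intro s
    have h1 : ContinuousAt (fun q : X × unitInterval ↦ σ q.1) (x₀, s) :=
      ContinuousAt.comp (f := Prod.fst) (x := (x₀, s)) hσ continuousAt_fst
    have h2 : ContinuousAt (fun q : X × unitInterval ↦ τ q.1) (x₀, s) :=
      ContinuousAt.comp (f := Prod.fst) (x := (x₀, s)) hτ continuousAt_fst
    have h3 : Continuous (fun q : X × unitInterval ↦ γ q.2) := by fun_prop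
    have h4 : Continuous (fun q : X × unitInterval ↦ (q.2 : ℝ)) := by fun_prop
    exact (h3.continuousAt.add ((continuousAt_const.sub h4.continuousAt).smul
      (h1.sub continuousAt_const))).add (h4.continuousAt.smul (h2.sub continuousAt_const))
  have hcF : ∀ s, ContinuousAt (fun q : X × unitInterval ↦ (q.1, c q)) (x₀, s) := fun s ↦
    continuousAt_fst.prodMk (hc s)
  have hmem : ∀ᶠ x in 𝓝 x₀, ∀ s : unitInterval, (x, c (x, s)) ∈ F := by
    have := isCompact_univ.eventually_forall_of_forall_eventually (x₀ := x₀)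
      (K := (univ : Set unitInterval)) (P := fun x s ↦ (x, c (x, s)) ∈ F) fun s _ ↦
        (hcF s).eventually (hF.mem_nhds (by simpa [hc0] using hγ s))
    simpa using this
  let G : unitInterval → ℂ := fun s ↦ g x₀ (γ s)
  have hG : Continuous G := (hg x₀).comp_continuous γ.continuous hγ
  let R : X × unitInterval → ℂ := fun q ↦ f (q.1, c q) * Complex.exp (-G q.2)
  have hR1 : ∀ s, R (x₀, s) = 1 := by
    intro s
    simp only [R, hc0, G]
    rw [← hgf x₀ _ (hγ s), ← Complex.exp_add]
    simp
  have hR : ∀ s, ContinuousAt R (x₀, s) := by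
    intro s
    refine ContinuousAt.mul ?_ (by fun_prop)
    exact ContinuousAt.comp (f := fun q : X × unitInterval ↦ (q.1, c q)) (x := (x₀, s))
      (hf.continuousAt (hF.mem_nhds (by simpa [hc0] using hγ s))) (hcF s)
  have hslit : ∀ᶠ x in 𝓝 x₀, ∀ s : unitInterval, R (x, s) ∈ Complex.slitPlane := by
    have := isCompact_univ.eventually_forall_of_forall_eventually (x₀ := x₀)
      (K := (univ : Set unitInterval)) (P := fun x s ↦ R (x, s) ∈ Complex.slitPlane) fun s _ ↦
        (hR s).eventually (Complex.isOpen_slitPlane.mem_nhds (by simp [hR1]))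
    simpa using this
  have hlogR : ∀ s : unitInterval, ContinuousAt (fun x ↦ Complex.log (R (x, s))) x₀ := by
    intro s
    refine ContinuousAt.clog ?_ (by simp [hR1])
    exact ContinuousAt.comp (f := fun x ↦ (x, s)) (x := x₀) (hR s) (by fun_prop)
  have hEq : (fun x ↦ g x (τ x) - g x (σ x)) =ᶠ[𝓝 x₀]
      fun x ↦ G 1 - G 0 + (Complex.log (R (x, 1)) - Complex.log (R (x, 0))) := by
    filter_upwards [hmem, hslit] with x hx hs
    have hcx : Continuous fun s ↦ c (x, s) := by
      simp only [c]
      fun_prop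
    have h1 : Continuous fun s ↦ g x (c (x, s)) := (hg x).comp_continuous hcx hx
    have h2 : Continuous fun s ↦ R (x, s) :=
      (hf.comp_continuous (continuous_const.prodMk hcx) hx).mul
        (Complex.continuous_exp.comp hG.neg)
    have := sub_eq_sub_of_exp_eq h1 (g₂ := fun s ↦ G s + Complex.log (R (x, s)))
      (hG.add (h2.clog hs)) (fun s ↦ by
      rw [Complex.exp_add, Complex.exp_log (Complex.slitPlane_ne_zero (hs s)), hgf x _ (hx s)]
      simp only [R]
      rw [mul_left_comm, ← Complex.exp_add]
      simp) 0 1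
    have hc0' : c (x, 0) = σ x := by simp [c]
    have hc1' : c (x, 1) = τ x := by simp [c]
    rw [hc0', hc1'] at this
    rw [this]
    ring
  refine ContinuousAt.congr ?_ hEq.symm
  exact continuousAt_const.add ((hlogR 1).sub (hlogR 0))

/-- A nonvanishing continuous function on an open set with simply connected slices has a continuous
logarithm. -/
theorem HasSimplyConnectedSlices.exists_continuousOn_exp_eq {E : Type*} [NormedAddCommGroup E]
    [NormedSpace ℂ E] {D : Set E} (hD : HasSimplyConnectedSlices D) (hDo : IsOpen D) {f : E → ℂ}
    (hf : ContinuousOn f D) (hf0 : ∀ x ∈ D, f x ≠ 0) :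
    ∃ g : E → ℂ, ContinuousOn g D ∧ ∀ x ∈ D, Complex.exp (g x) = f x := by
  rcases D.eq_empty_or_nonempty with rfl | ⟨a, ha⟩
  · exact ⟨0, by simp⟩
  have hsl : ∀ x : E, ∃ h : ℂ → ℂ, ContinuousOn h {t : ℂ | a + t • (x - a) ∈ D} ∧
      ∀ t : ℂ, a + t • (x - a) ∈ D → Complex.exp (h t) = f (a + t • (x - a)) := by
    intro x
    have hc : Continuous fun t : ℂ ↦ a + t • (x - a) := by fun_prop
    obtain ⟨h, h1, h2⟩ := Complex.exists_continuousOn_eqOn_exp_comp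
      (hD a (x - a) ⟨0, by simpa using ha⟩) (hDo.preimage hc)
      (hf.comp hc.continuousOn fun t ht ↦ ht) (by
        rintro ⟨t, ht, h0⟩
        exact hf0 _ ht h0)
    exact ⟨h, h1, fun t ht ↦ h2 ht⟩
  choose h hcont hexp using hsl
  have h0 : ∀ x, Complex.exp (h x 0) = f a := fun x ↦ by
    simpa using hexp x 0 (by simpa using ha)
  refine ⟨fun x ↦ h x 1 - h x 0 + h a 0, fun x₀ hx₀ ↦ ?_, fun x hx ↦ ?_⟩
  · refine ContinuousAt.continuousWithinAt (ContinuousAt.add ?_ continuousAt_const)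
    have hc : Continuous fun q : E × ℂ ↦ a + q.2 • (q.1 - a) := by fun_prop
    refine continuousAt_sub_of_exp_eq (F := {q : E × ℂ | a + q.2 • (q.1 - a) ∈ D})
      (f := fun q ↦ f (a + q.2 • (q.1 - a))) (hDo.preimage hc)
      (hf.comp hc.continuousOn fun t ht ↦ ht) hcont hexp (σ := fun _ ↦ (0 : ℂ))
      (τ := fun _ ↦ (1 : ℂ)) continuousAt_const continuousAt_const ?_
    exact (hD a (x₀ - a) ⟨0, by simpa using ha⟩).isPathConnected.joinedIn 0 (by simpa using ha) 1
      (by simpa using hx₀)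
  · rw [Complex.exp_add, Complex.exp_sub, h0, h0, div_mul_cancel₀ _ (hf0 a ha),
      hexp x 1 (by simpa using hx)]
    simp

/-- Averaging local sections logarithmically along the fibres, with weights from a partition of
unity, gives a globally defined continuous nonvanishing function. -/
theorem continuous_exp_finsum_of_exp_eq {X E ι : Type*} [TopologicalSpace X]
    [NormedAddCommGroup E] [NormedSpace ℝ E] {F : Set (X × E)} (hF : IsOpen F)
    {f : X × E → ℂ} (hf : ContinuousOn f F)
    {g : X → E → ℂ} (hg : ∀ x, ContinuousOn (g x) {e | (x, e) ∈ F})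
    (hgf : ∀ x e, (x, e) ∈ F → Complex.exp (g x e) = f (x, e))
    (hj : ∀ x e e', (x, e) ∈ F → (x, e') ∈ F → JoinedIn {e | (x, e) ∈ F} e e')
    {U : ι → Set X} (hU : ∀ i, IsOpen (U i)) {σ : ι → X → E} (hσ : ∀ i, ContinuousOn (σ i) (U i))
    (hσF : ∀ i, ∀ x ∈ U i, (x, σ i x) ∈ F) (ρ : PartitionOfUnity ι X univ)
    (hρ : ρ.IsSubordinate U) :
    Continuous fun x ↦ Complex.exp (∑ᶠ i, (ρ i x : ℂ) * g x (σ i x)) := by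
  rw [continuous_iff_continuousAt]
  intro x₀
  obtain ⟨I, hI⟩ := ρ.exists_finset_nhds x₀
  obtain ⟨k, hk⟩ : ∃ k, 0 < ρ k x₀ := ρ.exists_pos (mem_univ x₀)
  have hkU : x₀ ∈ U k := hρ k (subset_tsupport _ hk.ne')
  have hcont : ContinuousAt (fun x ↦ f (x, σ k x) *
      Complex.exp (∑ i ∈ I, (ρ i x : ℂ) * (g x (σ i x) - g x (σ k x)))) x₀ := by
    have hσk : ContinuousAt (σ k) x₀ := (hσ k).continuousAt ((hU k).mem_nhds hkU)
    refine ContinuousAt.mul ?_ (Complex.continuous_exp.continuousAt.comp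
      (tendsto_finsetSum _ fun i _ ↦ ?_))
    · exact ContinuousAt.comp (f := fun x ↦ (x, σ k x)) (x := x₀)
        (hf.continuousAt (hF.mem_nhds (hσF k x₀ hkU))) (continuousAt_id.prodMk hσk)
    · change ContinuousAt (fun x ↦ (ρ i x : ℂ) * (g x (σ i x) - g x (σ k x))) x₀
      by_cases hi : x₀ ∈ tsupport (ρ i)
      · have hiU := hρ i hi
        exact (Complex.continuous_ofReal.comp (ρ i).continuous).continuousAt.mul
          (continuousAt_sub_of_exp_eq hF hf hg hgf hσk
            ((hσ i).continuousAt ((hU i).mem_nhds hiU))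
            (hj _ _ _ (hσF k x₀ hkU) (hσF i x₀ hiU)))
      · refine ContinuousAt.congr (f := fun _ ↦ (0 : ℂ)) continuousAt_const ?_
        filter_upwards [notMem_tsupport_iff_eventuallyEq.mp hi] with x hx
        simp [hx]
  refine hcont.congr ?_
  filter_upwards [hI, (hU k).mem_nhds hkU] with x hx hxU
  have hsum : ∑ i ∈ I, (ρ i x : ℂ) = 1 := by
    exact_mod_cast hx.1
  rw [finsum_eq_sum_of_support_subset (s := I), ← hgf x _ (hσF k x hxU), ← Complex.exp_add]
  · simp only [mul_sub, Finset.sum_sub_distrib, ← Finset.sum_mul, hsum, one_mul]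
    ring_nf
  · intro i hi
    refine hx.2 fun h0 ↦ hi ?_
    simp only at h0
    simp [h0]

/-- There is no continuous nonvanishing function on the plane which equals `c / z` outside a
disc. -/
theorem false_of_continuous_eq_div {h : ℂ → ℂ} (hc : Continuous h) (h0 : ∀ z, h z ≠ 0) {c : ℂ}
    {r : ℝ} (hr : 0 < r) (hz : ∀ z : ℂ, ‖z‖ = r → h z = c / z) : False := by
  obtain ⟨L, hL, hLh⟩ := Complex.exists_continuousOn_eqOn_exp_comp isSimplyConnected_univ_complex
    isOpen_univ hc.continuousOn (by
      rintro ⟨z, -, hz⟩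
      exact h0 z hz)
  rw [continuousOn_univ] at hL
  have hexp : ∀ z, Complex.exp (L z) = h z := fun z ↦ hLh (mem_univ z)
  let k : ℝ → ℂ := fun θ ↦ L (r * Complex.exp (θ * Complex.I)) + θ * Complex.I
  have hk : Continuous k := by fun_prop
  have hkexp : ∀ θ, Complex.exp (k θ) = c / r := by
    intro θ
    have hr' : (r : ℂ) ≠ 0 := by exact_mod_cast hr.ne'
    simp only [k]
    rw [Complex.exp_add, hexp, hz _ (by
      rw [norm_mul, Complex.norm_exp_ofReal_mul_I, Complex.norm_real, Real.norm_of_nonneg hr.le,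
        mul_one])]
    field_simp [Complex.exp_ne_zero]
  have := Complex.isCoveringMap_exp.const_of_comp hk (fun a b ↦ by simp [hkexp]) 0 (2 * Real.pi)
  simp [k, Complex.exp_two_pi_mul_I] at this

/-- An open set with simply connected slices which misses a subspace of codimension two also misses
a subspace of codimension one containing it. -/
theorem HasSimplyConnectedSlices.exists_forall_notMem {P : Type*} [NormedAddCommGroup P]
    [NormedSpace ℂ P] {D : Set (P × ℂ × ℂ)} (hD : HasSimplyConnectedSlices D) (hDo : IsOpen D)
    (h0 : ∀ m, (m, 0, 0) ∉ D) :
    ∃ α β : ℂ, (α ≠ 0 ∨ β ≠ 0) ∧ ∀ m t, (m, t * α, t * β) ∉ D := by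
  by_contra! hcon
  let F : Set (ℂ × P × ℂ) := {q | (q.2.1, q.2.2 * q.1, q.2.2) ∈ D}
  have hF : IsOpen F := hDo.preimage (by fun_prop)
  have hFo : ∀ z, IsOpen {e | (z, e) ∈ F} := fun z ↦ hF.preimage (by fun_prop)
  have hFs : ∀ z, HasSimplyConnectedSlices {e | (z, e) ∈ F} := by
    intro z
    have := hD.preimage 0 ((LinearMap.fst ℂ P ℂ).prod
      ((z • LinearMap.snd ℂ P ℂ).prod (LinearMap.snd ℂ P ℂ)))
    simpa [F, mul_comm] using this
  have hF0 : ∀ z e, (z, e) ∈ F → e.2 ≠ 0 := by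
    rintro z ⟨m, t⟩ he rfl
    exact h0 m (by simpa [F] using he)
  choose g hg hgf using fun z ↦ (hFs z).exists_continuousOn_exp_eq (hFo z) (f := Prod.snd)
    continuous_snd.continuousOn (hF0 z)
  have hne : ∀ z : ℂ, ∃ e : P × ℂ, (z, e) ∈ F := by
    intro z
    obtain ⟨m, t, h⟩ := hcon z 1 (Or.inr one_ne_zero)
    exact ⟨(m, t), by simpa [F] using h⟩
  choose q hq using hne
  obtain ⟨m₀, t₀, hmt⟩ := hcon 1 0 (Or.inl one_ne_zero)
  rw [mul_one, mul_zero] at hmt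
  obtain ⟨δ, hδ, hball⟩ : ∃ δ > 0, ∀ w : ℂ, ‖w‖ < δ → (m₀, t₀, t₀ * w) ∈ D := by
    have hopen : IsOpen {w : ℂ | (m₀, t₀, t₀ * w) ∈ D} := hDo.preimage (by fun_prop)
    obtain ⟨δ, hδ, hb⟩ := Metric.isOpen_iff.mp hopen 0 (by simpa using hmt)
    exact ⟨δ, hδ, fun w hw ↦ hb (by simpa using hw)⟩
  let σ : Option ℂ → ℂ → P × ℂ := fun i z ↦ i.elim (m₀, t₀ / z) q
  let U : Option ℂ → Set ℂ := fun i ↦ i.elim {z | δ⁻¹ < ‖z‖}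
    fun i ↦ {z | (z, q i) ∈ F} ∩ {z | ‖z‖ < δ⁻¹ + 1}
  have hδi : 0 < δ⁻¹ := inv_pos.mpr hδ
  have hU : ∀ i, IsOpen (U i) := by
    rintro (_ | i)
    · exact isOpen_lt continuous_const continuous_norm
    · exact (hF.preimage (by fun_prop)).inter (isOpen_lt continuous_norm continuous_const)
  have hU0 : ∀ z ∈ U none, z ≠ 0 := by
    rintro z hz rfl
    have : δ⁻¹ < ‖(0 : ℂ)‖ := hz
    rw [norm_zero] at this
    exact lt_asymm this hδi
  have hσ : ∀ i, ContinuousOn (σ i) (U i) := by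
    rintro (_ | i)
    · exact continuousOn_const.prodMk (continuousOn_const.div continuousOn_id hU0)
    · exact continuousOn_const
  have hσF : ∀ i, ∀ z ∈ U i, (z, σ i z) ∈ F := by
    rintro (_ | i) z hz
    · have hz0 := hU0 z hz
      have hz' : δ⁻¹ < ‖z‖ := hz
      have := hball z⁻¹ (by
        rw [norm_inv]
        exact inv_lt_of_inv_lt₀ hδ hz')
      simpa [F, σ, hz0, div_eq_mul_inv] using this
    · exact hz.1
  have hcover : univ ⊆ ⋃ i, U i := by
    intro z _
    rw [mem_iUnion]
    rcases lt_or_ge δ⁻¹ ‖z‖ with h | h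
    · exact ⟨none, h⟩
    · exact ⟨some z, hq z, show ‖z‖ < δ⁻¹ + 1 by linarith⟩
  obtain ⟨ρ, hρ⟩ := PartitionOfUnity.exists_isSubordinate isClosed_univ U hU hcover
  have hcont := continuous_exp_finsum_of_exp_eq hF (f := fun p ↦ p.2.2) (by fun_prop) hg
    (fun z e he ↦ hgf z e he) (fun z _ _ he he' ↦ (hFs z).joinedIn he he') hU hσ hσF ρ hρ
  refine false_of_continuous_eq_div hcont (fun _ ↦ Complex.exp_ne_zero _) (c := t₀)
    (r := δ⁻¹ + 1) (by linarith) fun z hz ↦ ?_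
  have hzero : ∀ i ≠ none, ρ i z = 0 := by
    rintro (_ | i) hi
    · exact absurd rfl hi
    · by_contra h
      have : ‖z‖ < δ⁻¹ + 1 := (hρ (some i) (subset_tsupport _ h)).2
      exact this.ne hz
  have hone : ρ none z = 1 := by
    rw [← ρ.sum_eq_one (mem_univ z), finsum_eq_single _ none hzero]
  rw [finsum_eq_single _ none (fun i hi ↦ by simp [hzero i hi]), hone, Complex.ofReal_one, one_mul,
    hgf z _ (hσF none z (show δ⁻¹ < ‖z‖ by linarith))]
  rfl

/-- A subspace whose translate to `p` misses an open set with simply connected slices is contained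
in the kernel of a nonzero functional with the same property. -/
theorem HasSimplyConnectedSlices.exists_dual_ne_zero {E : Type*} [NormedAddCommGroup E]
    [NormedSpace ℂ E] [FiniteDimensional ℂ E] {D : Set E} (hD : HasSimplyConnectedSlices D)
    (hDo : IsOpen D) (hne : D.Nonempty) (p : E) (N : Submodule ℂ E) (hN : ∀ x ∈ N, p + x ∉ D) :
    ∃ f : E →L[ℂ] ℂ, f ≠ 0 ∧ (∀ x ∈ N, f x = 0) ∧ ∀ x, f x = 0 → p + x ∉ D := by
  obtain ⟨M, ⟨hNM, hM⟩, hmax⟩ := set_has_maximal_iff_noetherian.mpr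
    (inferInstanceAs (IsNoetherian ℂ E)) {M : Submodule ℂ E | N ≤ M ∧ ∀ x ∈ M, p + x ∉ D}
    ⟨N, le_rfl, hN⟩
  have hMtop : M ≠ ⊤ := by
    rintro rfl
    obtain ⟨x, hx⟩ := hne
    exact hM (x - p) trivial (by simpa using hx)
  obtain ⟨f, hf0, hMf⟩ := M.exists_le_ker_of_lt_top hMtop.lt_top
  refine ⟨f.toContinuousLinearMap, fun h ↦ hf0 (by simpa using h), fun x hx ↦ hMf (hNM hx), ?_⟩
  obtain ⟨u, hu⟩ : ∃ u, f u ≠ 0 := by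
    by_contra! h
    exact hf0 (LinearMap.ext h)
  have huM : u ∉ M := fun h ↦ hu (hMf h)
  intro x hx
  refine hM x ?_
  by_contra hxM
  have hxf : f x = 0 := hx
  let φ : M × ℂ × ℂ →ₗ[ℂ] E := M.subtype.coprod
    ((LinearMap.toSpanSingleton ℂ E u).coprod (LinearMap.toSpanSingleton ℂ E x))
  have hφ : ∀ m s t, φ (m, s, t) = m + (s • u + t • x) := fun m s t ↦ by simp [φ]
  obtain ⟨α, β, hαβ, hmiss⟩ := (hD.preimage p φ).exists_forall_notMem
    (hDo.preimage (continuous_const.add φ.continuous_of_finiteDimensional)) (fun m ↦ by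
      simpa [hφ] using hM m m.2)
  have hw : α • u + β • x ∉ M := by
    intro hw
    have h1 : α * f u = 0 := by simpa [hxf] using hMf hw
    have hα : α = 0 := (mul_eq_zero.mp h1).resolve_right hu
    have hβ : β ≠ 0 := hαβ.resolve_left (not_not.mpr hα)
    rw [hα, zero_smul, zero_add] at hw
    exact hxM ((M.smul_mem_iff hβ).mp hw)
  refine hmax (M ⊔ Submodule.span ℂ {α • u + β • x}) ⟨hNM.trans le_sup_left, fun y hy ↦ ?_⟩
    (left_lt_sup.mpr fun h ↦ hw (h (Submodule.mem_span_singleton_self _)))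
  obtain ⟨m, hm, w, hw', rfl⟩ := Submodule.mem_sup.mp hy
  obtain ⟨t, rfl⟩ := Submodule.mem_span_singleton.mp hw'
  have := hmiss ⟨m, hm⟩ t
  simpa [hφ, smul_add, smul_smul] using this

/-- Let `p ≠ q` be points of the closure of an open set with simply connected slices. The closure
meets small spheres around `p` in points of the complex line through `p` and `q`. -/
theorem HasSimplyConnectedSlices.exists_norm_eq {E : Type*} [NormedAddCommGroup E]
    [NormedSpace ℂ E] {D : Set E} (hD : HasSimplyConnectedSlices D) {p q : E}
    (hp : p ∈ closure D) (hq : q ∈ closure D) {ε : ℝ} (hε : 0 < ε) (hεpq : ε < ‖q - p‖) :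
    ∃ t : ℂ, p + t • (q - p) ∈ closure D ∧ ‖t • (q - p)‖ = ε := by
  by_contra! hcon
  set d := ‖q - p‖
  have hd : 0 < d := hε.trans hεpq
  have hK := (isCompact_closedBall (0 : ℂ) (2 * ε / d)).eventually_forall_of_forall_eventually
    (x₀ := (p, q))
    (P := fun (x : E × E) (t : ℂ) ↦ ¬(x.1 + t • (x.2 - x.1) ∈ closure D ∧
      ‖t • (x.2 - x.1)‖ = ε)) (fun t _ ↦ by
      have hclosed : IsClosed {z : (E × E) × ℂ | z.1.1 + z.2 • (z.1.2 - z.1.1) ∈ closure D ∧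
          ‖z.2 • (z.1.2 - z.1.1)‖ = ε} :=
        (isClosed_closure.preimage (by fun_prop)).inter
          (isClosed_eq (by fun_prop) continuous_const)
      exact hclosed.isOpen_compl.mem_nhds fun h ↦ hcon t h.1 h.2)
  have hdist : ∀ᶠ x : E × E in 𝓝 (p, q), max ε (d / 2) < ‖x.2 - x.1‖ :=
    (continuous_snd.sub continuous_fst).norm.continuousAt.eventually
      (lt_mem_nhds (max_lt hεpq (half_lt_self hd)))
  have hfreq : ∃ᶠ x : E × E in 𝓝 (p, q), x ∈ D ×ˢ D := by
    rw [← mem_closure_iff_frequently, closure_prod_eq]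
    exact ⟨hp, hq⟩
  obtain ⟨⟨a, b⟩, ⟨ha, hb⟩, hab, hmax⟩ := (hfreq.and_eventually (hK.and hdist)).exists
  simp only at ha hb hab hmax
  obtain ⟨hεab, hdab⟩ := max_lt_iff.mp hmax
  have hconn := (hD a (b - a) ⟨0, by simpa using ha⟩).isPathConnected.isConnected.isPreconnected
  obtain ⟨t, ht, hte⟩ := hconn.intermediate_value (a := 0) (b := 1) (by simpa using ha)
    (by simpa using hb) (f := fun t : ℂ ↦ ‖t • (b - a)‖) (by fun_prop)
    (show ε ∈ Icc _ _ from ⟨by simpa using hε.le, by simpa using hεab.le⟩)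
  refine hab t ?_ ⟨subset_closure ht, hte⟩
  rw [mem_closedBall_zero_iff, le_div_iff₀ hd]
  simp only [norm_smul] at hte
  nlinarith [norm_nonneg t]

/-- Let `D` be a bounded ℂ-convex domain in ℂⁿ that is strictly ℂ-convex. Then for every
boundary point `p ∈ ∂D` and every complex affine line `ℓ` with `p ∈ ℓ` and `ℓ ∩ D = ∅`,
one has `ℓ ∩ cl(D) = {p}`. -/
theorem strictlyCConvex_line_inter_closure {n : ℕ}
    (D : Set (EuclideanSpace ℂ (Fin n)))
    (hOpen : IsOpen D) (hConn : IsConnected D) (hBdd : Bornology.IsBounded D)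
    (hCC : IsCConvex D)
    (hStrict : ∀ q ∈ frontier D, StrictlyCConvexAt D q)
    (p : EuclideanSpace ℂ (Fin n)) (hp : p ∈ frontier D)
    (l : Set (EuclideanSpace ℂ (Fin n))) (hl : IsComplexAffineLine l)
    (hpl : p ∈ l) (hlD : l ∩ D = ∅) :
    l ∩ closure D = {p} := by
  have hs := hCC.hasSimplyConnectedSlices
  have hpD : p ∈ closure D := hp.1
  refine Subset.antisymm ?_ (singleton_subset_iff.mpr ⟨hpl, hpD⟩)
  rintro q ⟨hql, hqD⟩
  by_contra hne
  have hpq : q - p ≠ 0 := sub_ne_zero.mpr hne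
  obtain ⟨a, v, hv, rfl⟩ := hl
  obtain ⟨s, hs'⟩ := hpl
  obtain ⟨s', hs''⟩ := hql
  have hline : ∀ t : ℂ, p + t • (q - p) ∉ D := by
    intro t ht
    have hmem : p + t • (q - p) ∈ {x | ∃ t : ℂ, x = a + t • v} ∩ D := by
      refine ⟨⟨s + t * (s' - s), ?_⟩, ht⟩
      rw [hs', hs'']
      module
    rw [hlD] at hmem
    exact hmem
  obtain ⟨f, hf0, hfpq, hfD⟩ := hs.exists_dual_ne_zero hOpen hConn.nonempty p
    (Submodule.span ℂ {q - p}) (fun x hx ↦ by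
      obtain ⟨t, rfl⟩ := Submodule.mem_span_singleton.mp hx
      exact hline t)
  obtain ⟨U, hU, hpU, hUH⟩ := hStrict p hp
  have hH := hUH {x | f x = f p} ⟨f, f p, hf0, rfl⟩ rfl (by
    refine eq_empty_iff_forall_notMem.mpr fun x hx ↦ ?_
    have hx1 : f x = f p := hx.1
    exact hfD (x - p) (by rw [map_sub, hx1, sub_self]) (by simpa using hx.2))
  obtain ⟨ε, hε, hεU⟩ := Metric.isOpen_iff.mp hU p hpU
  have hd : 0 < ‖q - p‖ := norm_pos_iff.mpr hpq
  have hmin : 0 < min ε ‖q - p‖ := lt_min hε hd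
  obtain ⟨t, htD, hte⟩ := hs.exists_norm_eq hpD hqD (half_pos hmin)
    ((half_lt_self hmin).trans_le (min_le_right _ _))
  have hmem : p + t • (q - p) ∈ U ∩ closure D ∩ {x | f x = f p} := by
    refine ⟨⟨hεU ?_, htD⟩, ?_⟩
    · rw [Metric.mem_ball, dist_eq_norm, add_sub_cancel_left, hte]
      exact (half_lt_self hmin).trans_le (min_le_left _ _)
    · have := hfpq (q - p) (Submodule.mem_span_singleton_self _)
      simp only [mem_ofPred_eq, map_add, map_smul, this, smul_zero, add_zero]
  rw [hH, mem_singleton_iff, add_eq_left] at hmem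
  rw [hmem, norm_zero] at hte
  exact (half_pos hmin).ne hte
end

section
/- Let D be a bounded ℂ-convex domain in ℂ^{n+m} that is strictly ℂ-convex, and let π : ℂ^{n+m} → ℂⁿ be the projection onto the first n coordinates. Then every boundary point of the shadow π(D) is a strictly ℂ-convex boundary point of π(D). -/
open Set Topology Filter

/-- The preimage of a complex affine hyperplane under the first projection is a complex affine
hyperplane. -/
theorem IsComplexAffineHyperplane.preimage_fst {E F : Type*} [NormedAddCommGroup E]
    [NormedSpace ℂ E] [NormedAddCommGroup F] [NormedSpace ℂ F] {H : Set E}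
    (hH : IsComplexAffineHyperplane H) :
    IsComplexAffineHyperplane (Prod.fst ⁻¹' H : Set (E × F)) := by
  obtain ⟨f, c, hf, rfl⟩ := hH
  refine ⟨f.comp (ContinuousLinearMap.fst ℂ E F), c, fun h => hf ?_, rfl⟩
  ext x
  simpa using congrArg (fun g => g (x, (0 : F))) h

/-- If `D` is open with compact closure and strictly ℂ-convex, so is its shadow. -/
theorem StrictlyCConvexAt.image_fst {E F : Type*} [NormedAddCommGroup E]
    [NormedSpace ℂ E] [NormedAddCommGroup F] [NormedSpace ℂ F] {D : Set (E × F)}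
    (hD : IsOpen D) (hc : IsCompact (closure D))
    (hs : ∀ q ∈ frontier D, StrictlyCConvexAt D q) {p : E} (hp : p ∈ frontier (Prod.fst '' D)) :
    StrictlyCConvexAt (Prod.fst '' D) p := by
  have hcl : closure (Prod.fst '' D) = Prod.fst '' closure D :=
    (image_closure_of_isCompact hc continuous_fst.continuousOn).symm
  choose! U hUo hqU hU using hs
  set O : Set (E × F) := ⋃ q ∈ {q ∈ frontier D | q.1 = p}, U q
  have hOo : IsOpen O := isOpen_biUnion fun q hq => hUo q hq.1
  rw [(isOpenMap_fst D hD).frontier_eq] at hp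
  have hpO : p ∈ (Prod.fst '' (closure D \ O))ᶜ := by
    rintro ⟨q, ⟨hqD, hqO⟩, rfl⟩
    have hq : q ∈ frontier D := by
      rw [hD.frontier_eq]
      exact ⟨hqD, fun h => hp.2 (mem_image_of_mem _ h)⟩
    exact hqO (mem_biUnion ⟨hq, rfl⟩ (hqU q hq))
  refine ⟨(Prod.fst '' (closure D \ O))ᶜ,
    ((hc.diff hOo).image continuous_fst).isClosed.isOpen_compl, hpO, ?_⟩
  intro H hH hpH hHD
  have hdisj : (Prod.fst ⁻¹' H : Set (E × F)) ∩ D = ∅ := by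
    rw [← disjoint_iff_inter_eq_empty] at hHD ⊢
    exact disjoint_left.2 fun y hyH hyD =>
      disjoint_left.1 hHD hyH (mem_image_of_mem _ hyD)
  refine Subset.antisymm ?_ (singleton_subset_iff.2 ⟨⟨?_, hp.1⟩, hpH⟩)
  · rintro x ⟨⟨hxO, hx⟩, hxH⟩
    rw [hcl] at hx
    obtain ⟨y, hyD, rfl⟩ := hx
    have hyO : y ∈ O := by
      by_contra h
      exact hxO (mem_image_of_mem _ ⟨hyD, h⟩)
    obtain ⟨q, ⟨hq, rfl⟩, hyq⟩ := mem_iUnion₂.1 hyO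
    have hy : y ∈ U q ∩ closure D ∩ Prod.fst ⁻¹' H := ⟨⟨hyq, hyD⟩, hxH⟩
    rw [hU q hq _ hH.preimage_fst hpH hdisj, mem_singleton_iff] at hy
    rw [hy, mem_singleton_iff]
  · exact hpO

/-- Let `D` be a bounded ℂ-convex domain in `ℂ^{n+m} = ℂⁿ × ℂᵐ` that is strictly ℂ-convex,
and let `π = Prod.fst` be the projection onto the first `n` coordinates. Then every boundary
point of the shadow `π(D)` is a strictly ℂ-convex boundary point of `π(D)`. -/
theorem shadow_strictlyCConvex {n m : ℕ}
    (D : Set (EuclideanSpace ℂ (Fin n) × EuclideanSpace ℂ (Fin m)))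
    (hOpen : IsOpen D) (hConn : IsConnected D) (hBdd : Bornology.IsBounded D)
    (hCC : IsCConvex D)
    (hStrict : ∀ q ∈ frontier D, StrictlyCConvexAt D q) :
    ∀ p ∈ frontier (Prod.fst '' D), StrictlyCConvexAt (Prod.fst '' D) p := by
  intro p hp
  exact StrictlyCConvexAt.image_fst hOpen hBdd.isCompact_closure hStrict hp
end

section
/- Let D be a bounded ℂ-convex domain in ℂ^{n+m} that is strictly ℂ-convex and normal, and let π : ℂ^{n+m} → ℂⁿ be the projection onto the first n coordinates. Then the shadow π(D) is a normal domain in ℂⁿ. -/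
open Set Topology Filter

/-- `h` has a continuous branch of the logarithm on `S`. -/
def HasContLog {X : Type*} [TopologicalSpace X] (h : X → ℂ) (S : Set X) : Prop :=
  ∃ g : X → ℂ, ContinuousOn g S ∧ ∀ x ∈ S, Complex.exp (g x) = h x

theorem HasContLog.mono {X : Type*} [TopologicalSpace X] {h : X → ℂ} {S T : Set X}
    (hT : HasContLog h T) (hST : S ⊆ T) : HasContLog h S :=
  let ⟨g, hg, hgh⟩ := hT
  ⟨g, hg.mono hST, fun x hx => hgh x (hST hx)⟩

/-- Two continuous logarithms of the same function on a preconnected set agree as soon as they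
agree at one point. -/
theorem eqOn_of_exp_eq {X : Type*} [TopologicalSpace X] {S : Set X} (hS : IsPreconnected S)
    {g₁ g₂ : X → ℂ} (h₁ : ContinuousOn g₁ S) (h₂ : ContinuousOn g₂ S)
    (he : ∀ x ∈ S, Complex.exp (g₁ x) = Complex.exp (g₂ x)) {a : X} (ha : a ∈ S)
    (h : g₁ a = g₂ a) : EqOn g₁ g₂ S :=
  Complex.isCoveringMap_exp.eqOn_of_comp_eqOn hS h₁ h₂
    (fun x hx => Subtype.ext (he x hx)) ha h

/-- Continuous logarithms on two relatively closed pieces with preconnected intersection glue. -/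
theorem HasContLog.union {X : Type*} [TopologicalSpace X] {h : X → ℂ} {Q T₁ T₂ : Set X}
    (hT₁ : IsClosed T₁) (hT₂ : IsClosed T₂)
    (h₁ : HasContLog h (Q ∩ T₁)) (h₂ : HasContLog h (Q ∩ T₂))
    (hc : IsPreconnected (Q ∩ (T₁ ∩ T₂))) : HasContLog h (Q ∩ (T₁ ∪ T₂)) := by
  classical
  obtain ⟨g₁, hg₁, he₁⟩ := h₁
  obtain ⟨g₂, hg₂, he₂⟩ := h₂
  obtain ⟨d, hd, hdeq⟩ : ∃ d : ℂ, Complex.exp d = 1 ∧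
      ∀ x ∈ Q ∩ (T₁ ∩ T₂), g₁ x = g₂ x + d := by
    rcases (Q ∩ (T₁ ∩ T₂)).eq_empty_or_nonempty with h0 | ⟨a, ha⟩
    · exact ⟨0, Complex.exp_zero, by simp [h0]⟩
    have hd : Complex.exp (g₁ a - g₂ a) = 1 := by
      rw [Complex.exp_sub, he₁ a ⟨ha.1, ha.2.1⟩, he₂ a ⟨ha.1, ha.2.2⟩, div_self]
      rw [← he₁ a ⟨ha.1, ha.2.1⟩]
      exact Complex.exp_ne_zero _
    refine ⟨g₁ a - g₂ a, hd, eqOn_of_exp_eq hc (hg₁.mono fun x hx => ⟨hx.1, hx.2.1⟩)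
      ((hg₂.mono fun x hx => ⟨hx.1, hx.2.2⟩).add continuousOn_const) ?_ ha (by simp)⟩
    intro x hx
    rw [Complex.exp_add, hd, mul_one, he₁ x ⟨hx.1, hx.2.1⟩, he₂ x ⟨hx.1, hx.2.2⟩]
  set g : X → ℂ := fun x => if x ∈ T₁ then g₁ x else g₂ x + d with hgdef
  have e₁ : EqOn g g₁ (Q ∩ T₁) := fun x hx => if_pos hx.2
  have e₂ : EqOn g (fun x => g₂ x + d) (Q ∩ T₂) := by
    intro x hx
    by_cases hx1 : x ∈ T₁
    · simp only [hgdef, if_pos hx1]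
      exact hdeq x ⟨hx.1, hx1, hx.2⟩
    · exact if_neg hx1
  have c₁ : ContinuousOn g (Q ∩ T₁) := hg₁.congr e₁
  have c₂ : ContinuousOn g (Q ∩ T₂) := (hg₂.add continuousOn_const).congr e₂
  have vac : ∀ {T : Set X}, IsClosed T → ∀ x ∉ T, ContinuousWithinAt g (Q ∩ T) x := by
    intro T hT x hx
    refine continuousWithinAt_of_notMem_closure fun hcl => hx ?_
    exact hT.closure_subset_iff.2 inter_subset_right hcl
  refine ⟨g, fun x hx => ?_, fun x hx => ?_⟩
  · rw [inter_union_distrib_left]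
    refine ContinuousWithinAt.union ?_ ?_
    · by_cases hx1 : x ∈ T₁
      exacts [c₁ x ⟨hx.1, hx1⟩, vac hT₁ x hx1]
    · by_cases hx2 : x ∈ T₂
      exacts [c₂ x ⟨hx.1, hx2⟩, vac hT₂ x hx2]
  · rcases hx.2 with hx' | hx'
    · rw [e₁ ⟨hx.1, hx'⟩, he₁ x ⟨hx.1, hx'⟩]
    · rw [e₂ ⟨hx.1, hx'⟩, Complex.exp_add, hd, mul_one, he₂ x ⟨hx.1, hx'⟩]

/-- If an open subset of a product has nonempty preconnected fibres over a preconnected set `S`,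
then its part over `S` is preconnected. -/
theorem isPreconnected_inter_preimage_fst {B F : Type*} [TopologicalSpace B] [TopologicalSpace F]
    {Q : Set (B × F)} (hQ : IsOpen Q) {S : Set B} (hS : IsPreconnected S)
    (hne : ∀ b ∈ S, ∃ q, (b, q) ∈ Q) (hfib : ∀ b ∈ S, IsPreconnected {q | (b, q) ∈ Q}) :
    IsPreconnected (Q ∩ Prod.fst ⁻¹' S) := by
  rintro u v hu hv huv ⟨⟨b₁, q₁⟩, ⟨hq₁, hb₁⟩, hu₁⟩ ⟨⟨b₂, q₂⟩, ⟨hq₂, hb₂⟩, hv₂⟩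
  obtain ⟨b, hb, ⟨⟨x, hx, rfl⟩, ⟨y, hy, hyx⟩⟩⟩ :=
    hS (Prod.fst '' (Q ∩ u)) (Prod.fst '' (Q ∩ v))
      (isOpenMap_fst _ (hQ.inter hu)) (isOpenMap_fst _ (hQ.inter hv))
      (fun b hb => by
        obtain ⟨q, hq⟩ := hne b hb
        rcases huv ⟨hq, hb⟩ with h | h
        exacts [Or.inl ⟨_, ⟨hq, h⟩, rfl⟩, Or.inr ⟨_, ⟨hq, h⟩, rfl⟩])
      ⟨b₁, hb₁, _, ⟨hq₁, hu₁⟩, rfl⟩ ⟨b₂, hb₂, _, ⟨hq₂, hv₂⟩, rfl⟩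
  have hcont : Continuous fun q : F => (x.1, q) := by fun_prop
  have hyx' : (x.1, y.2) = y := Prod.ext hyx.symm rfl
  obtain ⟨q, hq, hqu, hqv⟩ := hfib x.1 hb _ _ (hu.preimage hcont) (hv.preimage hcont)
    (fun q hq => huv ⟨hq, hb⟩) ⟨x.2, hx.1, hx.2⟩
    ⟨y.2, by simpa [hyx'] using hy.1, by simpa [hyx'] using hy.2⟩
  exact ⟨(x.1, q), ⟨hq, hb⟩, hqu, hqv⟩

/-- Fibrewise logarithms, normalized along a constant section, fit together continuously. -/
theorem hasContLog_of_fibers {P F : Type*} [TopologicalSpace P] [NormedAddCommGroup F]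
    [NormedSpace ℝ F] {R : Set (P × F)} (hR : IsOpen R) {h : P × F → ℂ} (hh : ContinuousOn h R)
    (h0 : ∀ z ∈ R, h z ≠ 0) (q₀ : F) (c : ℂ)
    (hsec : ∀ z ∈ R, (z.1, q₀) ∈ R ∧ h (z.1, q₀) = Complex.exp c)
    (hjoin : ∀ z ∈ R, JoinedIn {q | (z.1, q) ∈ R} q₀ z.2)
    (hlog : ∀ z ∈ R, HasContLog (fun q => h (z.1, q)) {q | (z.1, q) ∈ R}) :
    HasContLog h R := by
  have key : ∀ b, ∃ G : F → ℂ, (b, q₀) ∈ R → ContinuousOn G {q | (b, q) ∈ R} ∧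
      (∀ q, (b, q) ∈ R → Complex.exp (G q) = h (b, q)) ∧ G q₀ = c := by
    intro b
    by_cases hb : (b, q₀) ∈ R
    · obtain ⟨g, hg, hge⟩ := hlog _ hb
      have h1 : Complex.exp (c - g q₀) = 1 := by
        rw [Complex.exp_sub, hge q₀ hb, ← (hsec _ hb).2, div_self (h0 _ hb)]
      refine ⟨fun q => g q + (c - g q₀), fun _ => ⟨hg.add continuousOn_const, fun q hq => ?_, ?_⟩⟩
      · rw [Complex.exp_add, h1, mul_one]
        exact hge q hq
      · ring
    · exact ⟨0, fun h => absurd h hb⟩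
  choose G hG using key
  refine ⟨fun z => G z.1 z.2, ?_, fun z hz => (hG z.1 (hsec z hz).1).2.1 z.2 hz⟩
  have slit : ∀ {z w : P × F}, ‖h z / h w - 1‖ < 1 → h z / h w ∈ Complex.slitPlane := by
    intro z w hzw
    refine Complex.mem_slitPlane_of_norm_lt_one (z := h z / h w - 1) hzw |> fun H => ?_
    simpa using H
  rintro ⟨b₁, q₁⟩ hz₁
  have hs₁ := (hsec _ hz₁).1
  obtain ⟨γ, hγ⟩ := hjoin _ hz₁
  simp only at γ hγ hs₁
  have hγR : ∀ s, (b₁, γ s) ∈ R := hγ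
  have ev : ∀ᶠ b in 𝓝 b₁, ∀ s ∈ (univ : Set unitInterval),
      (b, γ s) ∈ R ∧ ‖h (b, γ s) / h (b₁, γ s) - 1‖ < 1 := by
    refine isCompact_univ.eventually_forall_of_forall_eventually
      (P := fun b s => (b, γ s) ∈ R ∧ ‖h (b, γ s) / h (b₁, γ s) - 1‖ < 1) fun s _ => ?_
    have c1 : ContinuousAt (fun z : P × unitInterval => (z.1, γ z.2)) (b₁, s) := by fun_prop
    have c2 : ContinuousAt (fun z : P × unitInterval => (b₁, γ z.2)) (b₁, s) := by fun_prop
    have d1 : ContinuousAt (fun z : P × unitInterval => h (z.1, γ z.2)) (b₁, s) :=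
      ContinuousAt.comp (f := fun z : P × unitInterval => (z.1, γ z.2)) (g := h)
        (hh.continuousAt (hR.mem_nhds (hγR s))) c1
    have d2 : ContinuousAt (fun z : P × unitInterval => h (b₁, γ z.2)) (b₁, s) :=
      ContinuousAt.comp (f := fun z : P × unitInterval => (b₁, γ z.2)) (g := h)
        (hh.continuousAt (hR.mem_nhds (hγR s))) c2
    have d3 : ContinuousAt (fun z : P × unitInterval =>
        ‖h (z.1, γ z.2) / h (b₁, γ z.2) - 1‖) (b₁, s) :=
      ((d1.div d2 (h0 _ (hγR s))).sub continuousAt_const).norm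
    refine (c1.eventually (hR.mem_nhds (hγR s))).and (d3.eventually_lt_const ?_)
    simp [div_self (h0 _ (hγR s))]
  have step : ∀ᶠ b in 𝓝 b₁, G b q₁ = G b₁ q₁ + Complex.log (h (b, q₁) / h (b₁, q₁)) := by
    filter_upwards [ev] with b hb
    have hbR : ∀ s, (b, γ s) ∈ R := fun s => (hb s trivial).1
    have hb0 : (b, q₀) ∈ R := by simpa using hbR 0
    have gc : ContinuousOn γ univ := γ.continuous.continuousOn
    have l1 : ContinuousOn (fun s => G b (γ s)) univ := (hG b hb0).1.comp gc fun s _ => hbR s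
    have l2 : ContinuousOn (fun s => G b₁ (γ s)) univ := (hG b₁ hs₁).1.comp gc fun s _ => hγR s
    have m1 : ContinuousOn (fun s => h (b, γ s)) univ :=
      hh.comp (t := R) (f := fun s => (b, γ s)) (by fun_prop) fun s _ => hbR s
    have m2 : ContinuousOn (fun s => h (b₁, γ s)) univ :=
      hh.comp (t := R) (f := fun s => (b₁, γ s)) (by fun_prop) fun s _ => hγR s
    have l3 : ContinuousOn (fun s => G b₁ (γ s) +
        Complex.log (h (b, γ s) / h (b₁, γ s))) univ :=
      l2.add ((m1.div m2 fun s _ => h0 _ (hγR s)).clog fun s _ => slit (hb s trivial).2)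
    have := eqOn_of_exp_eq isPreconnected_univ l1 l3 (fun s _ => ?_) (mem_univ (0 : unitInterval))
      ?_ (mem_univ (1 : unitInterval))
    · simpa using this
    · rw [Complex.exp_add, Complex.exp_log, (hG b hb0).2.1 _ (hbR s),
        (hG b₁ hs₁).2.1 _ (hγR s), mul_div_cancel₀ _ (h0 _ (hγR s))]
      exact div_ne_zero (h0 _ (hbR s)) (h0 _ (hγR s))
    · have e1 := (hsec _ hb0).2
      have e2 := (hsec _ hs₁).2
      simp only at e1 e2
      simp only [Path.source, (hG b hb0).2.2, (hG b₁ hs₁).2.2, e1, e2]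
      rw [div_self (Complex.exp_ne_zero _), Complex.log_one, add_zero]
  have hcz : ContinuousAt h (b₁, q₁) := hh.continuousAt (hR.mem_nhds hz₁)
  have cr : ContinuousAt (fun z => h z / h (b₁, q₁)) (b₁, q₁) := hcz.div_const _
  have near : ∀ᶠ z in 𝓝 (b₁, q₁), z ∈ R ∧ ‖h z / h (b₁, q₁) - 1‖ < 1 := by
    refine (hR.eventually_mem hz₁).and
      ((cr.sub continuousAt_const).norm.eventually_lt_const ?_)
    simp [div_self (h0 _ hz₁)]
  rw [nhds_prod_eq] at near
  obtain ⟨pa, hpa, pb, hpb, hab⟩ := eventually_prod_iff.1 near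
  obtain ⟨r, hr, hball⟩ := Metric.eventually_nhds_iff_ball.1 hpb
  have hev : (fun z : P × F => G z.1 z.2) =ᶠ[𝓝 (b₁, q₁)]
      fun z => G b₁ q₁ + Complex.log (h z / h (b₁, q₁)) := by
    rw [nhds_prod_eq]
    filter_upwards [(step.and hpa).prod_mk (Metric.ball_mem_nhds q₁ hr)]
    rintro ⟨b, q⟩ ⟨⟨hb, hpb'⟩, hq⟩
    simp only at hb hpb' hq
    have hR' : ∀ q ∈ Metric.ball q₁ r, (b, q) ∈ R ∧ ‖h (b, q) / h (b₁, q₁) - 1‖ < 1 :=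
      fun q hq => hab hpb' (hball q hq)
    have hq₁ := Metric.mem_ball_self (x := q₁) hr
    have hb0 := (hsec _ (hR' q₁ hq₁).1).1
    simp only at hb0
    have l1 : ContinuousOn (G b) (Metric.ball q₁ r) := (hG b hb0).1.mono fun q hq => (hR' q hq).1
    have m1 : ContinuousOn (fun q => h (b, q)) (Metric.ball q₁ r) :=
      hh.comp (t := R) (f := fun q => (b, q)) (by fun_prop) fun q hq => (hR' q hq).1
    refine eqOn_of_exp_eq (Metric.isPreconnected_ball) l1
      (g₂ := fun q => G b₁ q₁ + Complex.log (h (b, q) / h (b₁, q₁)))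
      (continuousOn_const.add ((m1.div_const _).clog fun q hq => slit (hR' q hq).2))
      (fun q hq => ?_) hq₁ hb hq
    rw [Complex.exp_add, Complex.exp_log, (hG b hb0).2.1 _ (hR' q hq).1,
        (hG b₁ hs₁).2.1 _ hz₁, mul_div_cancel₀ _ (h0 _ hz₁)]
    exact div_ne_zero (h0 _ (hR' q hq).1) (h0 _ hz₁)
  refine (ContinuousAt.congr ?_ hev.symm).continuousWithinAt
  refine continuousAt_const.add (cr.clog (slit ?_))
  simp [div_self (h0 _ hz₁)]

/-- The intersections of `S` with complex lines through its points, read in an affine parameter,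
are simply connected. -/
def HasSimplyConnectedLines {F : Type*} [AddCommGroup F] [Module ℂ F] (S : Set F) : Prop :=
  ∀ a ∈ S, ∀ b ∈ S, IsSimplyConnected {s : ℂ | a + s • (b - a) ∈ S}

theorem IsCConvex.hasSimplyConnectedLines {E : Type*} [NormedAddCommGroup E] [NormedSpace ℂ E]
    {D : Set E} (hD : IsCConvex D) : HasSimplyConnectedLines D := by
  intro a ha b hb
  rcases eq_or_ne a b with rfl | hab
  · have : {s : ℂ | a + s • (a - a) ∈ D} = univ := by ext; simp [ha]
    rw [this]
    have : SimplyConnectedSpace (univ : Set ℂ) :=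
      (Homeomorph.Set.univ ℂ).toHomotopyEquiv.simplyConnectedSpace
    exact this
  · have hv : b - a ≠ 0 := sub_ne_zero.2 hab.symm
    have hL := hD {x | ∃ t : ℂ, x = a + t • (b - a)} ⟨a, b - a, hv, rfl⟩
      ⟨a, ⟨0, by simp⟩, ha⟩
    have hemb : IsEmbedding fun s : ℂ => a + s • (b - a) := by
      have h2 : IsEmbedding fun s : ℂ => s • (b - a) :=
        (LinearMap.isClosedEmbedding_of_injective
          (f := LinearMap.toSpanSingleton ℂ E (b - a)) (by
            rw [LinearMap.ker_toSpanSingleton _ hv])).isEmbedding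
      exact (Homeomorph.addLeft a).isEmbedding.comp h2
    have himg : (fun s : ℂ => a + s • (b - a)) '' {s : ℂ | a + s • (b - a) ∈ D} =
        {x | ∃ t : ℂ, x = a + t • (b - a)} ∩ D := by
      ext x
      constructor
      · rintro ⟨s, hs, rfl⟩
        exact ⟨⟨s, rfl⟩, hs⟩
      · rintro ⟨⟨s, rfl⟩, hs⟩
        exact ⟨s, hs, rfl⟩
    rw [← hemb.isSimplyConnected_image, himg]
    exact hL.2

theorem HasSimplyConnectedLines.joinedIn {F : Type*} [NormedAddCommGroup F] [NormedSpace ℂ F]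
    {S : Set F} (hS : HasSimplyConnectedLines S) {a b : F} (ha : a ∈ S) (hb : b ∈ S) :
    JoinedIn S a b := by
  have h := (hS a ha b hb).isPathConnected.joinedIn 0 (by simpa using ha) 1 (by simpa using hb)
  have := h.map_continuousOn (f := fun s : ℂ => a + s • (b - a)) (by fun_prop)
  simp only [zero_smul, add_zero, one_smul, add_sub_cancel] at this
  refine this.mono ?_
  rintro _ ⟨s, hs, rfl⟩
  exact hs

theorem HasSimplyConnectedLines.hasContLog {F : Type*} [NormedAddCommGroup F] [NormedSpace ℂ F]
    {S : Set F} (hS : HasSimplyConnectedLines S) (hSo : IsOpen S) {h : F → ℂ}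
    (hh : ContinuousOn h S) (h0 : ∀ x ∈ S, h x ≠ 0) : HasContLog h S := by
  rcases S.eq_empty_or_nonempty with rfl | ⟨a, ha⟩
  · exact ⟨0, by simp, by simp⟩
  set φ : F × ℂ → F := fun z => a + z.2 • (z.1 - a) with hφ
  have hφc : Continuous φ := by fun_prop
  set R : Set (F × ℂ) := {z | z.1 ∈ S ∧ φ z ∈ S} with hRdef
  have hR : IsOpen R := (hSo.preimage continuous_fst).inter (hSo.preimage hφc)
  have hsc : ∀ z ∈ R, {q | (z.1, q) ∈ R} = {s : ℂ | a + s • (z.1 - a) ∈ S} := by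
    intro z hz
    ext s
    simp [hRdef, hφ, hz.1]
  obtain ⟨g, hg, hge⟩ := hasContLog_of_fibers (h := fun z => h (φ z)) hR
    (hh.comp hφc.continuousOn fun z hz => hz.2) (fun z hz => h0 _ hz.2) 0 (Complex.log (h a))
    (fun z hz => ⟨⟨hz.1, by simpa [hφ] using ha⟩, by simp [hφ, Complex.exp_log (h0 a ha)]⟩)
    (fun z hz => by
      rw [hsc z hz]
      exact (hS a ha z.1 hz.1).isPathConnected.joinedIn 0 (by simpa using ha) _ hz.2)
    (fun z hz => by
      rw [hsc z hz]
      have hc : Continuous fun s : ℂ => a + s • (z.1 - a) := by fun_prop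
      obtain ⟨f, hf, hfe⟩ := Complex.exists_continuousOn_eqOn_exp_comp (hS a ha z.1 hz.1)
        (hSo.preimage hc) (g := fun s : ℂ => h (a + s • (z.1 - a)))
        (hh.comp hc.continuousOn fun s hs => hs) (by
          rintro ⟨s, hs, hs0⟩
          exact h0 _ hs hs0)
      exact ⟨f, hf, hfe⟩)
  have h1 : ∀ x ∈ S, (x, (1 : ℂ)) ∈ R := fun x hx => ⟨hx, by simpa [hφ] using hx⟩
  refine ⟨fun x => g (x, 1), hg.comp (by fun_prop) h1, fun x hx => ?_⟩
  simpa [hφ] using hge _ (h1 x hx)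

/-- A relation on the endpoints of intervals which is monotone, closed under concatenation and
locally true holds for every interval. -/
theorem interval_induction {P : ℝ → ℝ → Prop}
    (mono : ∀ a b a' b', a ≤ a' → b' ≤ b → P a b → P a' b')
    (trans : ∀ a b c, a ≤ b → b ≤ c → P a b → P b c → P a c)
    (loc : ∀ x, ∃ δ > 0, P (x - δ) (x + δ)) {a b : ℝ} (hab : a ≤ b) : P a b := by
  choose δ hδ hP using loc
  obtain ⟨t, ht0, htm, ⟨m, hm⟩, ht⟩ := exists_monotone_Icc_subset_open_cover_Icc hab
    (c := fun x : Icc a b => Subtype.val ⁻¹' Ioo (x - δ x : ℝ) (x + δ x))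
    (fun x => isOpen_Ioo.preimage continuous_subtype_val)
    (fun x _ => mem_iUnion.2 ⟨x, by simp [hδ]⟩)
  have small : ∀ n, P (t n) (t (n + 1)) := by
    intro n
    obtain ⟨x, hx⟩ := ht n
    have h1 := hx (left_mem_Icc.2 (htm n.le_succ))
    have h2 := hx (right_mem_Icc.2 (htm n.le_succ))
    exact mono _ _ _ _ h1.1.le h2.2.le (hP x)
  have all : ∀ n, P (t 0) (t (n + 1)) := by
    intro n
    induction n with
    | zero => exact small 0
    | succ n ih =>
      exact trans _ _ _ (htm (Nat.zero_le _)) (htm (Nat.le_succ _)) ih (small _)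
  have := all m
  rwa [hm (m + 1) (Nat.le_succ m), ht0] at this

/-- Local continuous logarithms over `ℂ` glue to a logarithm over any closed rectangle. -/
theorem hasContLog_over_rectangle {F : Type*} [TopologicalSpace F] {Q : Set (ℂ × F)}
    (hQ : IsOpen Q) {h : ℂ × F → ℂ} (hne : ∀ w, ∃ q, (w, q) ∈ Q)
    (hfib : ∀ w, IsPreconnected {q | (w, q) ∈ Q})
    (hloc : ∀ w, ∃ N ∈ 𝓝 w, HasContLog h (Q ∩ Prod.fst ⁻¹' N)) {a b c d : ℝ}
    (hab : a ≤ b) (hcd : c ≤ d) :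
    HasContLog h (Q ∩ Prod.fst ⁻¹' (Icc a b ×ℂ Icc c d)) := by
  have glue : ∀ S T : Set ℂ, IsClosed S → IsClosed T → IsPreconnected (S ∩ T) →
      HasContLog h (Q ∩ Prod.fst ⁻¹' S) → HasContLog h (Q ∩ Prod.fst ⁻¹' T) →
      HasContLog h (Q ∩ Prod.fst ⁻¹' (S ∪ T)) := fun S T hS hT hST h₁ h₂ =>
    h₁.union (hS.preimage continuous_fst) (hT.preimage continuous_fst) h₂
      (isPreconnected_inter_preimage_fst hQ hST (fun b _ => hne b) fun b _ => hfib b)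
  have hcl : ∀ a b c d : ℝ, IsClosed (Icc a b ×ℂ Icc c d) := fun a b c d =>
    isClosed_Icc.reProdIm isClosed_Icc
  have hpc : ∀ a b c d : ℝ, IsPreconnected (Icc a b ×ℂ Icc c d) := fun a b c d =>
    (((convex_Icc a b).linear_preimage Complex.reLm).inter
      ((convex_Icc c d).linear_preimage Complex.imLm)).isPreconnected
  have hm : ∀ {a b c d a' b' c' d' : ℝ}, a ≤ a' → b' ≤ b → c ≤ c' → d' ≤ d →
      HasContLog h (Q ∩ Prod.fst ⁻¹' (Icc a b ×ℂ Icc c d)) →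
      HasContLog h (Q ∩ Prod.fst ⁻¹' (Icc a' b' ×ℂ Icc c' d')) := by
    intro a b c d a' b' c' d' h1 h2 h3 h4 H
    refine H.mono fun z hz => ⟨hz.1, ?_⟩
    exact ⟨Icc_subset_Icc h1 h2 hz.2.1, Icc_subset_Icc h3 h4 hz.2.2⟩
  refine interval_induction
    (P := fun a b => HasContLog h (Q ∩ Prod.fst ⁻¹' (Icc a b ×ℂ Icc c d)))
    (fun a b a' b' h1 h2 => hm h1 h2 le_rfl le_rfl) ?_ (fun x => ?_) hab
  · intro a b e h1 h2 H1 H2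
    have e1 : Icc a e ×ℂ Icc c d = (Icc a b ×ℂ Icc c d) ∪ (Icc b e ×ℂ Icc c d) := by
      rw [← Icc_union_Icc_eq_Icc h1 h2]
      ext z
      simp only [Complex.mem_reProdIm, mem_union]
      tauto
    have e2 : (Icc a b ×ℂ Icc c d) ∩ (Icc b e ×ℂ Icc c d) = Icc b b ×ℂ Icc c d := by
      ext z
      simp only [Complex.mem_reProdIm, mem_inter_iff, mem_Icc]
      constructor
      · rintro ⟨⟨h3, h4⟩, h5, -⟩
        exact ⟨⟨h5.1, h3.2⟩, h4⟩
      · rintro ⟨h3, h4⟩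
        exact ⟨⟨⟨h1.trans h3.1, h3.2⟩, h4⟩, ⟨h3.1, h3.2.trans h2⟩, h4⟩
    rw [e1]
    exact glue _ _ (hcl _ _ _ _) (hcl _ _ _ _) (e2 ▸ hpc _ _ _ _) H1 H2
  · refine interval_induction
      (P := fun c d => ∃ δ > 0,
        HasContLog h (Q ∩ Prod.fst ⁻¹' (Icc (x - δ) (x + δ) ×ℂ Icc c d)))
      ?_ ?_ (fun y => ?_) hcd
    · rintro c d c' d' h1 h2 ⟨δ, hδ, H⟩
      exact ⟨δ, hδ, hm le_rfl le_rfl h1 h2 H⟩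
    · rintro c d e h1 h2 ⟨δ₁, hδ₁, H₁⟩ ⟨δ₂, hδ₂, H₂⟩
      refine ⟨min δ₁ δ₂, lt_min hδ₁ hδ₂, ?_⟩
      have l1 := min_le_left δ₁ δ₂
      have l2 := min_le_right δ₁ δ₂
      generalize min δ₁ δ₂ = δ at l1 l2
      have e1 : Icc (x - δ) (x + δ) ×ℂ Icc c e =
          (Icc (x - δ) (x + δ) ×ℂ Icc c d) ∪ (Icc (x - δ) (x + δ) ×ℂ Icc d e) := by
        rw [← Icc_union_Icc_eq_Icc h1 h2]
        ext z
        simp only [Complex.mem_reProdIm, mem_union]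
        tauto
      have e2 : (Icc (x - δ) (x + δ) ×ℂ Icc c d) ∩ (Icc (x - δ) (x + δ) ×ℂ Icc d e) =
          Icc (x - δ) (x + δ) ×ℂ Icc d d := by
        ext z
        simp only [Complex.mem_reProdIm, mem_inter_iff, mem_Icc]
        constructor
        · rintro ⟨⟨h3, h4⟩, -, h5⟩
          exact ⟨h3, h5.1, h4.2⟩
        · rintro ⟨h3, h4⟩
          exact ⟨⟨h3, h1.trans h4.1, h4.2⟩, h3, h4.1, h4.2.trans h2⟩
      rw [e1]
      refine glue _ _ (hcl _ _ _ _) (hcl _ _ _ _) (e2 ▸ hpc _ _ _ _)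
        (hm ?_ ?_ le_rfl le_rfl H₁) (hm ?_ ?_ le_rfl le_rfl H₂) <;> linarith
    · obtain ⟨N, hN, H⟩ := hloc ⟨x, y⟩
      obtain ⟨r, hr, hrN⟩ := Metric.mem_nhds_iff.1 hN
      refine ⟨r / 4, by positivity, r / 4, by positivity, H.mono fun z hz => ⟨hz.1, hrN ?_⟩⟩
      have h1 := hz.2.1
      have h2 := hz.2.2
      simp only [mem_preimage, mem_Icc] at h1 h2
      rw [Metric.mem_ball, dist_eq_norm]
      refine (Complex.norm_le_abs_re_add_abs_im _).trans_lt ?_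
      have h3 : |(z.1 - ⟨x, y⟩ : ℂ).re| ≤ r / 4 := by
        rw [Complex.sub_re, abs_le]; constructor <;> linarith
      have h4 : |(z.1 - ⟨x, y⟩ : ℂ).im| ≤ r / 4 := by
        rw [Complex.sub_im, abs_le]; constructor <;> linarith
      linarith

/-- The identity has no continuous logarithm along a circle around the origin. -/
theorem not_exists_periodic_log {ε : ℝ} {k : ℝ → ℂ} (hk : Continuous k)
    (he : ∀ θ : ℝ, Complex.exp (k θ) = ε * Complex.exp (θ * Complex.I))
    (hper : k (2 * Real.pi) = k 0) : False := by
  have h := eqOn_of_exp_eq isPreconnected_univ hk.continuousOn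
    (g₂ := fun θ : ℝ => k 0 + θ * Complex.I) (by fun_prop)
    (fun θ _ => by rw [Complex.exp_add, he θ, he 0]; simp) (mem_univ 0) (by simp)
    (mem_univ (2 * Real.pi))
  rw [hper, left_eq_add] at h
  simp [Real.pi_ne_zero] at h

/-- For an open set `D` with simply connected complex line sections which misses `p + W`, the
subspaces `p + W + ℂ (u + w v)`, `w ∈ ℂ`, and `p + W + ℂ v` cannot all meet `D`. -/
theorem false_of_forall_direction_meets {E : Type*} [NormedAddCommGroup E] [NormedSpace ℂ E]
    {D : Set E} (hDo : IsOpen D) (hD : HasSimplyConnectedLines D) {p : E} {W : Submodule ℂ E}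
    (hW : ∀ x ∈ W, p + x ∉ D) {u v : E}
    (hu : ∀ w : ℂ, ∃ t : ℂ, ∃ x ∈ W, p + t • (u + w • v) + x ∈ D)
    (hv : ∃ t : ℂ, ∃ x ∈ W, p + t • v + x ∈ D) : False := by
  set Φ : ℂ × (ℂ × W) → E := fun z => p + z.2.1 • (u + z.1 • v) + (z.2.2 : E) with hΦ
  have hΦc : Continuous Φ := by fun_prop
  set Q : Set (ℂ × (ℂ × W)) := Φ ⁻¹' D with hQdef
  have hQ : IsOpen Q := hDo.preimage hΦc
  have hne : ∀ w, ∃ q, (w, q) ∈ Q := by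
    intro w
    obtain ⟨t, x, hx, h⟩ := hu w
    exact ⟨(t, ⟨x, hx⟩), h⟩
  have ht0 : ∀ z ∈ Q, z.2.1 ≠ 0 := by
    intro z hz h0
    refine hW z.2.2 z.2.2.2 ?_
    have : Φ z ∈ D := hz
    simpa [hΦ, h0] using this
  have hlines : ∀ w, HasSimplyConnectedLines {q | (w, q) ∈ Q} := by
    intro w a ha b hb
    have h := hD _ ha _ hb
    convert h using 1
    ext s
    simp only [mem_ofPred_eq, hQdef, mem_preimage]
    rw [iff_iff_eq]
    congr 1
    simp only [hΦ, Prod.fst_add, Prod.snd_add, Prod.smul_fst, Prod.smul_snd, Prod.fst_sub,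
      Prod.snd_sub, Submodule.coe_add, Submodule.coe_smul, Submodule.coe_sub, smul_eq_mul]
    module
  have hfo : ∀ w, IsOpen {q | (w, q) ∈ Q} := fun w => hQ.preimage (by fun_prop)
  have hjoin : ∀ z ∈ Q, ∀ q, (z.1, q) ∈ Q → JoinedIn {q | (z.1, q) ∈ Q} q z.2 :=
    fun z hz q hq => (hlines z.1).joinedIn hq hz
  have hloc : ∀ w, ∃ N ∈ 𝓝 w,
      HasContLog (fun z : ℂ × (ℂ × W) => z.2.1) (Q ∩ Prod.fst ⁻¹' N) := by
    intro w
    obtain ⟨q₀, hq₀⟩ := hne w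
    have hNo : IsOpen {w' | (w', q₀) ∈ Q} := hQ.preimage (by fun_prop)
    refine ⟨{w' | (w', q₀) ∈ Q}, hNo.mem_nhds hq₀, ?_⟩
    have hfib : ∀ z ∈ Q ∩ Prod.fst ⁻¹' {w' | (w', q₀) ∈ Q},
        {q | (z.1, q) ∈ Q ∩ Prod.fst ⁻¹' {w' | (w', q₀) ∈ Q}} = {q | (z.1, q) ∈ Q} := by
      intro z hz
      ext q
      exact ⟨fun h => h.1, fun h => ⟨h, hz.2⟩⟩
    refine hasContLog_of_fibers (hQ.inter (hNo.preimage continuous_fst)) (by fun_prop)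
      (fun z hz => ht0 z hz.1) q₀ (Complex.log q₀.1)
      (fun z hz => ⟨⟨hz.2, hz.2⟩, (Complex.exp_log (ht0 _ hq₀)).symm⟩)
      (fun z hz => ?_) fun z hz => ?_
    · rw [hfib z hz]
      exact hjoin z hz.1 q₀ hz.2
    · rw [hfib z hz]
      exact (hlines z.1).hasContLog (hfo z.1) (by fun_prop) fun q hq => ht0 _ hq
  have hfib : ∀ w, IsPreconnected {q | (w, q) ∈ Q} := fun w =>
    isPreconnected_of_forall_pair fun x hx y hy =>
      let ⟨γ, hγ⟩ := (hlines w).joinedIn hx hy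
      ⟨range γ, range_subset_iff.2 hγ, ⟨0, γ.source⟩, ⟨1, γ.target⟩,
        isPreconnected_range γ.continuous⟩
  obtain ⟨β, x, hx, hβ⟩ := hv
  have hev : ∀ᶠ z : ℂ in 𝓝 0, p + (z • u + β • v) + x ∈ D := by
    have hc : ContinuousAt (fun z : ℂ => p + (z • u + β • v) + x) 0 := by fun_prop
    exact hc.eventually (hDo.mem_nhds (by simpa using hβ))
  obtain ⟨r, hr, hball⟩ := Metric.eventually_nhds_iff_ball.1 hev
  set ε := r / 2 with hε
  have hε0 : 0 < ε := by positivity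
  set t : ℝ → ℂ := fun θ => ε * Complex.exp (θ * Complex.I) with htdef
  have htc : Continuous t := by fun_prop
  have htn : ∀ θ, ‖t θ‖ = ε := fun θ => by
    simp [htdef, Complex.norm_exp_ofReal_mul_I, abs_of_pos hε0]
  have htne : ∀ θ, t θ ≠ 0 := fun θ h => by
    have := htn θ
    simp [h] at this
    linarith
  set σ : ℝ → ℂ × (ℂ × W) := fun θ => (β / t θ, (t θ, ⟨x, hx⟩)) with hσ
  have hσc : Continuous σ := (continuous_const.div htc htne).prodMk (by fun_prop)
  have hσQ : ∀ θ, σ θ ∈ Q := by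
    intro θ
    have h1 := hball (t θ) (by rw [mem_ball_zero_iff, htn]; linarith)
    have h2 : Φ (σ θ) = p + (t θ • u + β • v) + x := by
      simp only [hΦ, hσ, smul_add, smul_smul, mul_div_cancel₀ _ (htne θ)]
    change Φ (σ θ) ∈ D
    rwa [h2]
  have hRnn : 0 ≤ ‖β‖ / ε := by positivity
  obtain ⟨g, hg, hge⟩ := hasContLog_over_rectangle hQ hne hfib hloc
    (a := -(‖β‖ / ε)) (b := ‖β‖ / ε) (c := -(‖β‖ / ε)) (d := ‖β‖ / ε)
    (by linarith) (by linarith)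
  have hσR : ∀ θ, σ θ ∈ Q ∩ Prod.fst ⁻¹'
      (Icc (-(‖β‖ / ε)) (‖β‖ / ε) ×ℂ Icc (-(‖β‖ / ε)) (‖β‖ / ε)) := by
    intro θ
    have hn : ‖(σ θ).1‖ = ‖β‖ / ε := by simp [hσ, htn]
    exact ⟨hσQ θ, abs_le.1 (hn ▸ Complex.abs_re_le_norm _),
      abs_le.1 (hn ▸ Complex.abs_im_le_norm _)⟩
  refine not_exists_periodic_log (ε := ε) (hg.comp_continuous hσc hσR)
    (fun θ => hge _ (hσR θ)) ?_
  have : t (2 * Real.pi) = t 0 := by simp [htdef]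
  simp only [Function.comp_apply, hσ, this]

/-- An affine subspace missing an open ℂ-convex set lies in a complex hyperplane missing it. -/
theorem IsCConvex.exists_functional {E : Type*} [NormedAddCommGroup E] [NormedSpace ℂ E]
    [FiniteDimensional ℂ E] {D : Set E} (hDo : IsOpen D) (hD : IsCConvex D) (hne : D.Nonempty)
    {p : E} {W₀ : Submodule ℂ E} (hW₀ : ∀ x ∈ W₀, p + x ∉ D) :
    ∃ f : E →L[ℂ] ℂ, f ≠ 0 ∧ (∀ x ∈ W₀, f x = 0) ∧ ∀ x ∈ D, f x ≠ f p := by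
  obtain ⟨W, ⟨hW₀W, hW⟩, hmax⟩ := (set_has_maximal_iff_noetherian (R := ℂ) (M := E)).2 inferInstance
    {W | W₀ ≤ W ∧ ∀ x ∈ W, p + x ∉ D} ⟨W₀, le_rfl, hW₀⟩
  have hmeet : ∀ y ∉ W, ∃ t : ℂ, ∃ x ∈ W, p + t • y + x ∈ D := by
    intro y hy
    by_contra! hcon
    refine hmax (W ⊔ Submodule.span ℂ {y}) ⟨hW₀W.trans le_sup_left, fun x hx => ?_⟩ ?_
    · obtain ⟨ω, hω, z, hz, rfl⟩ := Submodule.mem_sup.1 hx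
      obtain ⟨t, rfl⟩ := Submodule.mem_span_singleton.1 hz
      have := hcon t ω hω
      rwa [add_assoc, add_comm (t • y) ω] at this
    · refine lt_of_le_of_ne le_sup_left fun h => hy ?_
      rw [h]
      exact Submodule.mem_sup_right (Submodule.mem_span_singleton_self y)
  obtain ⟨x₀, hx₀⟩ := hne
  have hu : x₀ - p ∉ W := fun h => hW _ h (by simpa using hx₀)
  set u := x₀ - p
  have htop : ∀ v, v ∈ W ⊔ Submodule.span ℂ {u} := by
    intro v
    by_contra hv
    have hvW : v ∉ W := fun h => hv (Submodule.mem_sup_left h)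
    have huv : ∀ w : ℂ, u + w • v ∉ W := by
      intro w h
      rcases eq_or_ne w 0 with rfl | hw
      · exact hu (by simpa using h)
      · refine hv ?_
        have hv' : v = w⁻¹ • ((u + w • v) - u) := by
          rw [add_sub_cancel_left, smul_smul, inv_mul_cancel₀ hw, one_smul]
        rw [hv']
        exact Submodule.smul_mem _ _ (Submodule.sub_mem _ (Submodule.mem_sup_left h)
          (Submodule.mem_sup_right (Submodule.mem_span_singleton_self u)))
    exact false_of_forall_direction_meets hDo hD.hasSimplyConnectedLines hW
      (fun w => hmeet _ (huv w)) (hmeet v hvW)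
  obtain ⟨f, hfu, hfW⟩ := Submodule.exists_dual_map_eq_bot_of_notMem hu inferInstance
  have hf0 : ∀ x ∈ W, f x = 0 := fun x hx => by
    have := Submodule.mem_map_of_mem (f := f) hx
    rwa [hfW, Submodule.mem_bot] at this
  refine ⟨LinearMap.toContinuousLinearMap f, fun h => hfu ?_, fun x hx => hf0 x (hW₀W hx),
    fun x hx hxp => ?_⟩
  · simpa using congrArg (fun F : E →L[ℂ] ℂ => F u) h
  · obtain ⟨ω, hω, z, hz, hsum⟩ := Submodule.mem_sup.1 (htop (x - p))
    obtain ⟨t, rfl⟩ := Submodule.mem_span_singleton.1 hz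
    have h1 : f (x - p) = 0 := by
      rw [map_sub, sub_eq_zero]
      exact hxp
    rw [← hsum, map_add, hf0 ω hω, map_smul, zero_add, smul_eq_mul,
      mul_eq_zero, or_iff_left hfu] at h1
    refine hW ω hω ?_
    have : p + ω = x := by
      rw [h1, zero_smul, add_zero] at hsum
      rw [hsum, add_sub_cancel]
    rwa [this]

/-- In the closure of a bounded ℂ-convex set, the part over a point `p` of a linear image that
contains two distinct points contains points at every small distance from either of them. -/
theorem IsCConvex.exists_mem_closure_dist_eq {E F : Type*} [NormedAddCommGroup E]
    [NormedSpace ℂ E] [FiniteDimensional ℂ E] [NormedAddCommGroup F] [NormedSpace ℂ F]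
    {D : Set E} (hD : IsCConvex D) (hb : Bornology.IsBounded D) (L : E →L[ℂ] F) {a b : E}
    (ha : a ∈ closure D) (hbD : b ∈ closure D) (hL : L a = L b) {r : ℝ} (hr : 0 ≤ r)
    (hrab : r < dist a b) : ∃ x ∈ closure D, L x = L a ∧ dist x a = r := by
  have : ProperSpace E := FiniteDimensional.proper ℂ E
  obtain ⟨α, hα, hαa⟩ := mem_closure_iff_seq_limit.1 ha
  obtain ⟨β, hβ, hβb⟩ := mem_closure_iff_seq_limit.1 hbD
  have hdist : Tendsto (fun j => dist (α j) (β j)) atTop (𝓝 (dist a b)) := hαa.dist hβb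
  have hlines := hD.hasSimplyConnectedLines
  have hex : ∀ j, ∃ x ∈ D, r < dist (α j) (β j) →
      dist x (α j) = r ∧ ‖L x - L (α j)‖ ≤ ‖L (β j) - L (α j)‖ := by
    intro j
    by_cases hj : r < dist (α j) (β j)
    · have hpc := (hlines _ (hα j) _ (hβ j)).isPathConnected.isConnected.isPreconnected
      have hcont : ContinuousOn (fun s : ℂ => ‖s • (β j - α j)‖)
          {s : ℂ | α j + s • (β j - α j) ∈ D} := by fun_prop
      obtain ⟨s, hs, hsr⟩ := hpc.intermediate_value (a := 0) (b := 1) (by simpa using hα j)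
        (by simpa using hβ j) hcont (show r ∈ Icc _ _ from
          ⟨by simpa using hr, by simpa [← dist_eq_norm, dist_comm] using hj.le⟩)
      refine ⟨_, hs, fun _ => ⟨?_, ?_⟩⟩
      · rw [dist_eq_norm, add_sub_cancel_left]
        exact hsr
      · rw [map_add, add_sub_cancel_left, map_smul, map_sub, norm_smul]
        refine mul_le_of_le_one_left (norm_nonneg _) ?_
        simp only [norm_smul] at hsr
        rw [← dist_eq_norm, dist_comm] at hsr
        by_contra! h1
        nlinarith
    · exact ⟨α j, hα j, fun h => absurd h hj⟩
  choose x hxD hx using hex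
  obtain ⟨y, hy, φ, hφ, hlim⟩ := tendsto_subseq_of_bounded hb hxD
  have hφt := hφ.tendsto_atTop
  have hev : ∀ᶠ j in atTop, r < dist (α (φ j)) (β (φ j)) :=
    (hdist.comp hφt).eventually_const_lt hrab
  refine ⟨y, hy, ?_, ?_⟩
  · have h1 : Tendsto (fun j => ‖L (x (φ j)) - L (α (φ j))‖) atTop (𝓝 ‖L y - L a‖) :=
      (((L.continuous.tendsto y).comp hlim).sub
        ((L.continuous.tendsto a).comp (hαa.comp hφt))).norm
    have h2 : Tendsto (fun j => ‖L (β (φ j)) - L (α (φ j))‖) atTop (𝓝 ‖L b - L a‖) :=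
      (((L.continuous.tendsto b).comp (hβb.comp hφt)).sub
        ((L.continuous.tendsto a).comp (hαa.comp hφt))).norm
    have h3 := le_of_tendsto_of_tendsto h1 h2 (hev.mono fun j hj => (hx _ hj).2)
    rw [hL, sub_self, norm_zero] at h3
    rw [← sub_eq_zero, ← norm_le_zero_iff, hL]
    exact h3
  · have h1 : Tendsto (fun j => dist (x (φ j)) (α (φ j))) atTop (𝓝 (dist y a)) :=
      hlim.dist (hαa.comp hφt)
    exact tendsto_nhds_unique h1
      (tendsto_const_nhds.congr' (hev.mono fun j hj => (hx _ hj).1.symm))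

/-- Over a boundary point of the shadow of a bounded strictly ℂ-convex domain, the closure of the
domain has at most one point. -/
theorem eq_of_fst_eq_of_notMem_shadow {E F : Type*} [NormedAddCommGroup E] [NormedSpace ℂ E]
    [FiniteDimensional ℂ E] [NormedAddCommGroup F] [NormedSpace ℂ F] [FiniteDimensional ℂ F]
    {D : Set (E × F)} (hOpen : IsOpen D) (hBdd : Bornology.IsBounded D) (hCC : IsCConvex D)
    (hStrict : ∀ q ∈ frontier D, StrictlyCConvexAt D q) {a b : E × F} (ha : a ∈ closure D)
    (hb : b ∈ closure D) (hab : a.1 = b.1) (hnot : a.1 ∉ Prod.fst '' D) : a = b := by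
  by_contra hne
  have hW : ∀ x ∈ LinearMap.ker (LinearMap.fst ℂ E F), a + x ∉ D := by
    intro x hx h
    refine hnot ⟨_, h, ?_⟩
    have : x.1 = 0 := hx
    simp [this]
  obtain ⟨f, hf, hfW, hfD⟩ := hCC.exists_functional hOpen (closure_nonempty_iff.1 ⟨a, ha⟩) hW
  have haf : a ∈ frontier D := by
    rw [hOpen.frontier_eq]
    exact ⟨ha, fun h => hnot ⟨a, h, rfl⟩⟩
  obtain ⟨U, hU, haU, hUH⟩ := hStrict a haf
  have hsing := hUH {x | f x = f a} ⟨f, f a, hf, rfl⟩ rfl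
    (eq_empty_of_forall_notMem fun x hx => hfD x hx.2 hx.1)
  obtain ⟨r, hr, hball⟩ := Metric.isOpen_iff.1 hU a haU
  have hd : 0 < dist a b := dist_pos.2 hne
  have hr' : 0 < min r (dist a b) / 2 := by positivity
  have h1 := min_le_left r (dist a b)
  have h2 := min_le_right r (dist a b)
  obtain ⟨x, hx, hxa, hxr⟩ := hCC.exists_mem_closure_dist_eq hBdd (ContinuousLinearMap.fst ℂ E F)
    ha hb hab hr'.le (by linarith)
  have hmem : x ∈ U ∩ closure D ∩ {x | f x = f a} := by
    refine ⟨⟨hball ?_, hx⟩, ?_⟩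
    · rw [Metric.mem_ball, hxr]
      linarith
    · have h3 := hfW (x - a) (by
        rw [LinearMap.mem_ker, map_sub, sub_eq_zero]
        exact hxa)
      rwa [map_sub, sub_eq_zero] at h3
  rw [hsing] at hmem
  rw [show x = a from hmem, dist_self] at hxr
  linarith

/-- Let `D` be a bounded ℂ-convex domain in `ℂ^{n+m} = ℂⁿ × ℂᵐ` that is strictly ℂ-convex
and normal, and let `π = Prod.fst` be the projection onto the first `n` coordinates. Then
the shadow `π(D)` is a normal domain in ℂⁿ. -/
theorem shadow_normal {n m : ℕ}
    (D : Set (EuclideanSpace ℂ (Fin n) × EuclideanSpace ℂ (Fin m)))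
    (hOpen : IsOpen D) (hConn : IsConnected D) (hBdd : Bornology.IsBounded D)
    (hCC : IsCConvex D)
    (hStrict : ∀ q ∈ frontier D, StrictlyCConvexAt D q)
    (hNormal : ∀ q ∈ frontier D, NormalAt D q) :
    (IsOpen (Prod.fst '' D) ∧ IsConnected (Prod.fst '' D) ∧
      Bornology.IsBounded (Prod.fst '' D)) ∧
    ∀ p ∈ frontier (Prod.fst '' D), NormalAt (Prod.fst '' D) p := by
  have hShadowOpen : IsOpen (Prod.fst '' D) := isOpenMap_fst D hOpen
  refine ⟨⟨hShadowOpen, hConn.image _ continuous_fst.continuousOn, ?_⟩, fun p hp => ?_⟩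
  · exact hBdd.image_fst
  have hcpt : IsCompact (closure D) := hBdd.isCompact_closure
  have hpD : p ∉ Prod.fst '' D := by
    rw [hShadowOpen.frontier_eq] at hp
    exact hp.2
  obtain ⟨q, hq, rfl⟩ : p ∈ Prod.fst '' closure D :=
    closure_minimal (image_mono subset_closure) (hcpt.image continuous_fst).isClosed
      (frontier_subset_closure hp)
  have hqf : q ∈ frontier D := by
    rw [hOpen.frontier_eq]
    exact ⟨hq, fun h => hpD ⟨q, h, rfl⟩⟩
  intro U hU hpU
  obtain ⟨V, hV, hqV, -, hjoin⟩ := hNormal q hqf (Prod.fst ⁻¹' U) (hU.preimage continuous_fst) hpU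
  have hK : IsClosed (Prod.fst '' (closure D \ V)) :=
    ((hcpt.diff hV).image continuous_fst).isClosed
  have hlift : ∀ x ∈ (U \ Prod.fst '' (closure D \ V)) ∩ Prod.fst '' D,
      ∃ z ∈ V ∩ D, z.1 = x := by
    rintro _ ⟨⟨-, hx⟩, z, hz, rfl⟩
    refine ⟨z, ⟨?_, hz⟩, rfl⟩
    by_contra hzV
    exact hx ⟨z, ⟨subset_closure hz, hzV⟩, rfl⟩
  refine ⟨U \ Prod.fst '' (closure D \ V), hU.sdiff hK, ⟨hpU, ?_⟩, sdiff_subset, ?_⟩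
  · rintro ⟨z, ⟨hz, hzV⟩, hzq⟩
    have := eq_of_fst_eq_of_notMem_shadow hOpen hBdd hCC hStrict hq hz hzq.symm hpD
    exact hzV (this ▸ hqV)
  · intro x hx y hy
    obtain ⟨x', hx', rfl⟩ := hlift x hx
    obtain ⟨y', hy', rfl⟩ := hlift y hy
    refine ((hjoin x' hx' y' hy').map continuous_fst).mono ?_
    rintro _ ⟨z, ⟨hzU, hzD⟩, rfl⟩
    exact ⟨hzU, z, hzD, rfl⟩
end
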